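/- For every A ⊆ ℕ the following are equivalent: (1) A is low for 1-randomness; (2) A is low for weak 2-random tests; (3) A is low for weak 2-randomness. -/

import Mathlib

open MeasureTheory Filter

namespace LMD

/-- Codes for partial functions recursive in an oracle. -/
inductive OracleCode : Type
  | zero : OracleCode
  | succ : OracleCode
  | left : OracleCode
  | right : OracleCode
  | oracle : OracleCode
  | pair : OracleCode → OracleCode → OracleCode
  | comp : OracleCode → OracleCode → OracleCode
  | prec : OracleCode → OracleCode → OracleCode
  | rfind' : OracleCode → OracleCode

namespace OracleCode

/-- Evaluation of an oracle code relative to a (total) oracle `O : ℕ → ℕ`. -/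
def eval (O : ℕ → ℕ) : OracleCode → ℕ →. ℕ
  | zero => pure 0
  | succ => Nat.succ
  | left => ↑fun n : ℕ => n.unpair.1
  | right => ↑fun n : ℕ => n.unpair.2
  | oracle => ↑fun n : ℕ => O n
  | pair cf cg => fun n => Nat.pair <$> eval O cf n <*> eval O cg n
  | comp cf cg => fun n => eval O cg n >>= eval O cf
  | prec cf cg =>
    Nat.unpaired fun a n =>
      n.rec (eval O cf a) fun y IH => do
        let i ← IH
        eval O cg (Nat.pair a (Nat.pair y i))
  | rfind' cf =>
    Nat.unpaired fun a m =>
      (Nat.rfind fun n => (fun m => m = 0) <$> eval O cf (Nat.pair a (n + m))).map (· + m)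

/-- A Gödel numbering of oracle codes. -/
def encodeCode : OracleCode → ℕ
  | zero => 0
  | succ => 1
  | left => 2
  | right => 3
  | oracle => 4
  | pair cf cg => 4 * Nat.pair (encodeCode cf) (encodeCode cg) + 5
  | comp cf cg => 4 * Nat.pair (encodeCode cf) (encodeCode cg) + 6
  | prec cf cg => 4 * Nat.pair (encodeCode cf) (encodeCode cg) + 7
  | rfind' cf => 4 * encodeCode cf + 8

end OracleCode

/-- `f` is partial recursive in the oracle `O`. -/
def RecursiveIn (O : ℕ → ℕ) (f : ℕ →. ℕ) : Prop := ∃ c : OracleCode, c.eval O = f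

/-- The characteristic function of a set of naturals. -/
noncomputable def chi (A : Set ℕ) : ℕ → ℕ := A.indicator fun _ => 1

/-- Turing reducibility between sets of naturals. -/
def TuringLE (A B : Set ℕ) : Prop := RecursiveIn (chi B) (chi A)

/-- The Turing jump of a set of naturals. -/
def jump (B : Set ℕ) : Set ℕ :=
  {e | ∃ c : OracleCode, c.encodeCode = e ∧ (c.eval (chi B) e).Dom}

/-- The open subset of Cantor space generated by a set of finite binary strings. -/
def Cyl (W : Set (List Bool)) : Set (ℕ → Bool) :=
  {X | ∃ σ ∈ W, ∀ i : Fin σ.length, X i = σ.get i}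

/-- The fair-coin product measure on Cantor space, realized as the pushforward of
Lebesgue measure on `[0,1)` under the binary expansion map. -/
noncomputable def mu : Measure (ℕ → Bool) :=
  Measure.map (fun x n => decide (⌊x * 2 ^ (n + 1)⌋₊ % 2 = 1))
    (volume.restrict (Set.Ico (0 : ℝ) 1))

/-- `W` is a c.e.-in-`A` set of binary strings. -/
def CeIn (A : Set ℕ) (W : Set (List Bool)) : Prop :=
  ∃ c : OracleCode, ∀ σ : List Bool, σ ∈ W ↔ (c.eval (chi A) (Encodable.encode σ)).Dom

/-- `W` is a uniformly c.e.-in-`A` sequence of sets of binary strings. -/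
def CeSeqIn (A : Set ℕ) (W : ℕ → Set (List Bool)) : Prop :=
  ∃ c : OracleCode, ∀ (n : ℕ) (σ : List Bool),
    σ ∈ W n ↔ (c.eval (chi A) (Nat.pair n (Encodable.encode σ))).Dom

/-- A Martin-Löf test relative to `A`. -/
def MLTest (A : Set ℕ) (U : ℕ → Set (ℕ → Bool)) : Prop :=
  ∃ W : ℕ → Set (List Bool), CeSeqIn A W ∧ (∀ n, U n = Cyl (W n)) ∧
    (∀ n, U (n + 1) ⊆ U n) ∧ ∀ n, mu (U n) ≤ 2⁻¹ ^ n

/-- `X` is Martin-Löf random relative to `A`. -/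
def MLRandom (A : Set ℕ) (X : ℕ → Bool) : Prop :=
  ∀ U : ℕ → Set (ℕ → Bool), MLTest A U → X ∉ ⋂ n, U n

/-- `A ≤_LR B`: every `B`-random is `A`-random. -/
def LRle (A B : Set ℕ) : Prop := ∀ X : ℕ → Bool, MLRandom B X → MLRandom A X

/-- Evaluation of an oracle machine on binary strings. -/
def evalStr (c : OracleCode) (O : ℕ → ℕ) (σ : List Bool) : Part (List Bool) :=
  (c.eval O (Encodable.encode σ)).bind fun m => Part.ofOption (Encodable.decode m)

/-- `c` is a prefix-free oracle machine: for every oracle its domain is prefix-free. -/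
def PrefixFreeMachine (c : OracleCode) : Prop :=
  ∀ (O : ℕ → ℕ) (σ₁ σ₂ : List Bool), σ₁ <+: σ₂ →
    (evalStr c O σ₁).Dom → (evalStr c O σ₂).Dom → σ₁ = σ₂

/-- `u` is a universal prefix-free oracle machine. -/
def UniversalPFM (u : OracleCode) : Prop :=
  PrefixFreeMachine u ∧
    ∀ c : OracleCode, PrefixFreeMachine c → ∃ d : ℕ, ∀ (O : ℕ → ℕ) (σ τ : List Bool),
      τ ∈ evalStr c O σ → ∃ σ' : List Bool, τ ∈ evalStr u O σ' ∧ σ'.length ≤ σ.length + d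

/-- Prefix-free Kolmogorov complexity relative to the oracle `O`,
measured by the universal machine `u` (`⊤` if `τ` is not in the range). -/
noncomputable def K (u : OracleCode) (O : ℕ → ℕ) (τ : List Bool) : ℕ∞ :=
  ⨅ σ ∈ {σ : List Bool | τ ∈ evalStr u O σ}, (σ.length : ℕ∞)

/-- `A ≤_LK B` with respect to the universal machine `u`. -/
def LKle (u : OracleCode) (A B : Set ℕ) : Prop :=
  ∃ d : ℕ, ∀ τ : List Bool, K u (chi B) τ ≤ K u (chi A) τ + (d : ℕ∞)


/-- A generalized Martin-Löf test relative to `A`. -/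
def GenMLTest (A : Set ℕ) (U : ℕ → Set (ℕ → Bool)) : Prop :=
  ∃ W : ℕ → Set (List Bool), CeSeqIn A W ∧ (∀ n, U n = Cyl (W n)) ∧
    (∀ n, U (n + 1) ⊆ U n) ∧ mu (⋂ n, U n) = 0

/-- `X` is weakly 2-random relative to `A`. -/
def W2Random (A : Set ℕ) (X : ℕ → Bool) : Prop :=
  ∀ U : ℕ → Set (ℕ → Bool), GenMLTest A U → X ∉ ⋂ n, U n

/-- `A` is low for weak 2-random tests. -/
def LowForW2Tests (A : Set ℕ) : Prop :=
  ∀ V : ℕ → Set (ℕ → Bool), GenMLTest A V →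
    ∃ U : ℕ → Set (ℕ → Bool), GenMLTest ∅ U ∧ (⋂ n, V n) ⊆ ⋂ n, U n

/-- `A` is low for weak 2-randomness. -/
def LowForW2Randomness (A : Set ℕ) : Prop :=
  ∀ X : ℕ → Bool, W2Random ∅ X → W2Random A X

section PrimrecFunProp

attribute [fun_prop] Primrec PrimrecPred
attribute [fun_prop] Primrec.id Primrec.const Primrec.comp Primrec.fst Primrec.snd Primrec.pair
  Primrec.encode Primrec.decode

variable {α β γ : Type*} [Primcodable α] [Primcodable β] [Primcodable γ]

@[fun_prop]
theorem primrec_fst_comp {f : α → β × γ} (hf : Primrec f) : Primrec fun a => (f a).1 :=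
  Primrec.fst.comp hf

@[fun_prop]
theorem primrec_snd_comp {f : α → β × γ} (hf : Primrec f) : Primrec fun a => (f a).2 :=
  Primrec.snd.comp hf

@[fun_prop]
theorem primrec_add {f g : α → ℕ} (hf : Primrec f) (hg : Primrec g) :
    Primrec fun a => f a + g a :=
  Primrec.nat_add.comp hf hg

@[fun_prop]
theorem primrec_sub {f g : α → ℕ} (hf : Primrec f) (hg : Primrec g) :
    Primrec fun a => f a - g a :=
  Primrec.nat_sub.comp hf hg

@[fun_prop]
theorem primrec_mul {f g : α → ℕ} (hf : Primrec f) (hg : Primrec g) :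
    Primrec fun a => f a * g a :=
  Primrec.nat_mul.comp hf hg

@[fun_prop]
theorem primrec_pow {f g : α → ℕ} (hf : Primrec f) (hg : Primrec g) :
    Primrec fun a => f a ^ g a :=
  (Primrec₂.unpaired'.1 Nat.Primrec.pow).comp hf hg

@[fun_prop]
theorem primrec_natPair {f g : α → ℕ} (hf : Primrec f) (hg : Primrec g) :
    Primrec fun a => Nat.pair (f a) (g a) :=
  Primrec₂.natPair.comp hf hg

@[fun_prop]
theorem primrec_unpair {f : α → ℕ} (hf : Primrec f) : Primrec fun a => Nat.unpair (f a) :=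
  Primrec.unpair.comp hf

@[fun_prop]
theorem primrec_encode_comp {f : α → β} (hf : Primrec f) :
    Primrec fun a => Encodable.encode (f a) :=
  Primrec.encode.comp hf

@[fun_prop]
theorem primrec_decode_comp {f : α → ℕ} (hf : Primrec f) :
    Primrec fun a => (Encodable.decode (f a) : Option β) :=
  Primrec.decode.comp hf

@[fun_prop]
theorem primrec_getD {f : α → Option β} {g : α → β} (hf : Primrec f) (hg : Primrec g) :
    Primrec fun a => (f a).getD (g a) :=
  Primrec.option_getD.comp hf hg

@[fun_prop]
theorem primrec_length {f : α → List β} (hf : Primrec f) : Primrec fun a => (f a).length :=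
  Primrec.list_length.comp hf

@[fun_prop]
theorem primrec_range {f : α → ℕ} (hf : Primrec f) : Primrec fun a => List.range (f a) :=
  Primrec.list_range.comp hf

@[fun_prop]
theorem primrec_take {f : α → ℕ} {g : α → List β} (hf : Primrec f) (hg : Primrec g) :
    Primrec fun a => (g a).take (f a) :=
  Primrec.list_take.comp hf hg

@[fun_prop]
theorem primrec_append {f g : α → List β} (hf : Primrec f) (hg : Primrec g) :
    Primrec fun a => f a ++ g a :=
  Primrec.list_append.comp hf hg

@[fun_prop]
theorem primrec_cons {f : α → β} {g : α → List β} (hf : Primrec f) (hg : Primrec g) :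
    Primrec fun a => f a :: g a :=
  Primrec.list_cons.comp hf hg

@[fun_prop]
theorem primrec_flatten {f : α → List (List β)} (hf : Primrec f) :
    Primrec fun a => (f a).flatten :=
  Primrec.list_flatten.comp hf

@[fun_prop]
theorem primrec_getElem? {f : α → List β} {g : α → ℕ} (hf : Primrec f) (hg : Primrec g) :
    Primrec fun a => (f a)[g a]? :=
  Primrec.list_getElem?.comp hf hg

@[fun_prop]
theorem primrec_map {f : α → List β} {g : α → β → γ} (hf : Primrec f)
    (hg : Primrec fun p : α × β => g p.1 p.2) : Primrec fun a => (f a).map (g a) :=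
  Primrec.list_map hf hg

@[fun_prop]
theorem primrec_flatMap {f : α → List β} {g : α → β → List γ} (hf : Primrec f)
    (hg : Primrec fun p : α × β => g p.1 p.2) : Primrec fun a => (f a).flatMap (g a) :=
  Primrec.list_flatMap hf hg

@[fun_prop]
theorem primrec_ite {c : α → Prop} [DecidablePred c] {f g : α → β} (hc : PrimrecPred c)
    (hf : Primrec f) (hg : Primrec g) : Primrec fun a => if c a then f a else g a :=
  Primrec.ite hc hf hg

@[fun_prop]
theorem primrec_decide {c : α → Prop} [DecidablePred c] (hc : PrimrecPred c) :
    Primrec fun a => decide (c a) :=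
  hc.decide

@[fun_prop]
theorem primrec_natRec {f : α → ℕ} {g : α → β} {h : α → ℕ → β → β} (hf : Primrec f)
    (hg : Primrec g) (hh : Primrec fun p : α × ℕ × β => h p.1 p.2.1 p.2.2) :
    Primrec fun a => (Nat.rec (g a) (h a) (f a) : β) :=
  Primrec.nat_rec' hf hg (h := fun a p => h a p.1 p.2) hh

@[fun_prop]
theorem primrec_sum_range {f : α → ℕ} {g : α → ℕ → ℕ} (hf : Primrec f)
    (hg : Primrec fun p : α × ℕ => g p.1 p.2) :
    Primrec fun a => ∑ i ∈ Finset.range (f a), g a i := by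
  have h : Primrec fun a => (Nat.rec 0 (fun i s => s + g a i) (f a) : ℕ) := by
    fun_prop
  refine h.of_eq fun a => ?_
  induction f a with
  | zero => rfl
  | succ n ih => rw [Finset.sum_range_succ, ← ih]

@[fun_prop]
theorem primrecPred_comp {f : α → β} {p : β → Prop} (hp : PrimrecPred p) (hf : Primrec f) :
    PrimrecPred fun a => p (f a) :=
  hp.comp hf

@[fun_prop]
theorem primrecPred_const (p : Prop) : PrimrecPred fun _ : α => p := by
  by_cases h : p
  · exact (Primrec.eq.comp (Primrec.const 0) (Primrec.const 0)).of_eq fun a => by simp [h]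
  · exact (Primrec.eq.comp (Primrec.const 0) (Primrec.const 1)).of_eq fun a => by simp [h]

@[fun_prop]
theorem primrecPred_and {p q : α → Prop} (hp : PrimrecPred p) (hq : PrimrecPred q) :
    PrimrecPred fun a => p a ∧ q a :=
  hp.and hq

@[fun_prop]
theorem primrecPred_not {p : α → Prop} (hp : PrimrecPred p) : PrimrecPred fun a => ¬ p a :=
  hp.not

@[fun_prop]
theorem primrecPred_eq {f g : α → β} (hf : Primrec f) (hg : Primrec g) :
    PrimrecPred fun a => f a = g a :=
  Primrec.eq.comp hf hg

@[fun_prop]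
theorem primrecPred_le {f g : α → ℕ} (hf : Primrec f) (hg : Primrec g) :
    PrimrecPred fun a => f a ≤ g a :=
  Primrec.nat_le.comp hf hg

@[fun_prop]
theorem primrecPred_lt {f g : α → ℕ} (hf : Primrec f) (hg : Primrec g) :
    PrimrecPred fun a => f a < g a :=
  Primrec.nat_lt.comp hf hg

@[fun_prop]
theorem primrecPred_forall_mem {f : α → List β} {p : α → β → Prop} (hf : Primrec f)
    (hp : PrimrecPred fun x : α × β => p x.1 x.2) : PrimrecPred fun a => ∀ b ∈ f a, p a b :=
  (PrimrecRel.forall_mem_list (R := fun b a => p a b)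
    (hp.comp (Primrec.snd.pair Primrec.fst))).comp hf Primrec.id

@[fun_prop]
theorem primrecPred_exists_mem {f : α → List β} {p : α → β → Prop} (hf : Primrec f)
    (hp : PrimrecPred fun x : α × β => p x.1 x.2) : PrimrecPred fun a => ∃ b ∈ f a, p a b :=
  (PrimrecRel.exists_mem_list (R := fun b a => p a b)
    (hp.comp (Primrec.snd.pair Primrec.fst))).comp hf Primrec.id

@[fun_prop]
theorem primrecPred_forall_lt {f : α → ℕ} {p : α → ℕ → Prop} (hf : Primrec f)
    (hp : PrimrecPred fun x : α × ℕ => p x.1 x.2) : PrimrecPred fun a => ∀ n < f a, p a n :=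
  (primrecPred_forall_mem (Primrec.list_range.comp hf) hp).of_eq fun a => by simp

@[fun_prop]
theorem primrecPred_exists_lt {f : α → ℕ} {p : α → ℕ → Prop} (hf : Primrec f)
    (hp : PrimrecPred fun x : α × ℕ => p x.1 x.2) : PrimrecPred fun a => ∃ n < f a, p a n :=
  (primrecPred_exists_mem (Primrec.list_range.comp hf) hp).of_eq fun a => by simp

@[fun_prop]
theorem primrecPred_prefix {f g : α → List β} (hf : Primrec f) (hg : Primrec g) :
    PrimrecPred fun a => f a <+: g a := by
  have h : PrimrecPred fun a => f a = (g a).take (f a).length := by fun_prop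
  exact h.of_eq fun a => List.prefix_iff_eq_take.symm

end PrimrecFunProp

section Pre

/-- The initial segment of `X` of length `n`. -/
def pre (X : ℕ → Bool) (n : ℕ) : List Bool := (List.range n).map X

@[simp] theorem length_pre (X : ℕ → Bool) (n : ℕ) : (pre X n).length = n := by simp [pre]

@[simp] theorem pre_zero (X : ℕ → Bool) : pre X 0 = [] := rfl

theorem pre_succ (X : ℕ → Bool) (n : ℕ) : pre X (n + 1) = pre X n ++ [X n] := by
  simp [pre, List.range_succ]

@[simp] theorem getElem_pre (X : ℕ → Bool) (n i : ℕ) (h : i < (pre X n).length) :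
    (pre X n)[i] = X i := by
  simp [pre]

theorem getElem?_pre (X : ℕ → Bool) {n i : ℕ} (h : i < n) : (pre X n)[i]? = some (X i) := by
  simp [pre, h]

theorem take_pre (X : ℕ → Bool) (k n : ℕ) : (pre X n).take k = pre X (min k n) := by
  rw [pre, ← List.map_take, List.take_range, pre]

theorem take_pre_of_le (X : ℕ → Bool) {k n : ℕ} (h : k ≤ n) : (pre X n).take k = pre X k := by
  rw [take_pre, min_eq_left h]

theorem pre_prefix (X : ℕ → Bool) {m n : ℕ} (h : m ≤ n) : pre X m <+: pre X n := by
  rw [← take_pre_of_le X h]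
  exact List.take_prefix _ _

theorem pre_eq_iff {X : ℕ → Bool} {n : ℕ} {σ : List Bool} :
    pre X n = σ ↔ n = σ.length ∧ ∀ (i : ℕ) (h : i < σ.length), X i = σ[i] := by
  constructor
  · rintro rfl
    simp
  · rintro ⟨rfl, h⟩
    apply List.ext_getElem (by simp)
    intro i h1 h2
    rw [getElem_pre, h]

theorem pre_eq_pre_iff {X Y : ℕ → Bool} {n : ℕ} :
    pre X n = pre Y n ↔ ∀ i < n, X i = Y i := by
  simp [pre]

theorem eq_pre_of_prefix {X : ℕ → Bool} {n : ℕ} {σ : List Bool} (h : σ <+: pre X n) :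
    σ = pre X σ.length := by
  have h1 := h.length_le
  rw [length_pre] at h1
  rw [List.prefix_iff_eq_take] at h
  rwa [take_pre_of_le X h1] at h

theorem mem_Cyl {W : Set (List Bool)} {X : ℕ → Bool} : X ∈ Cyl W ↔ ∃ n, pre X n ∈ W := by
  constructor
  · rintro ⟨σ, hσ, h⟩
    refine ⟨σ.length, ?_⟩
    rwa [pre_eq_iff.2 ⟨rfl, fun i hi => h ⟨i, hi⟩⟩]
  · rintro ⟨n, h⟩
    exact ⟨_, h, fun i => by simp⟩

end Pre

/-- `p` is a `Σ₁` predicate relative to the oracle `Z`: a primitive recursive predicate,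
monotone in finite initial segments of the oracle, enumerates it. -/
def Sig (Z : ℕ → Bool) {β : Type*} [Primcodable β] (p : β → Prop) : Prop :=
  ∃ R : β → List Bool → Prop, (PrimrecPred fun x : β × List Bool => R x.1 x.2) ∧
    (∀ a l l', l <+: l' → R a l → R a l') ∧ ∀ a, p a ↔ ∃ s, R a (pre Z s)

namespace Sig

variable {Z : ℕ → Bool} {α β γ : Type*} [Primcodable α] [Primcodable β] [Primcodable γ]

theorem of_eq {p q : β → Prop} (hp : Sig Z p) (h : ∀ a, p a ↔ q a) : Sig Z q := by
  obtain rfl : p = q := funext fun a => propext (h a)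
  exact hp

/-- The monotonicity requirement in `Sig` can always be arranged. -/
theorem mk {p : β → Prop} (R : β → List Bool → Prop)
    (hR : PrimrecPred fun x : β × List Bool => R x.1 x.2)
    (h : ∀ a, p a ↔ ∃ s, R a (pre Z s)) : Sig Z p := by
  refine ⟨fun a l => ∃ k < l.length + 1, R a (l.take k), by fun_prop, ?_, ?_⟩
  · rintro a l l' hl ⟨k, hk, hR⟩
    have := hl.length_le
    refine ⟨k, by omega, ?_⟩
    rw [List.prefix_iff_eq_take] at hl
    rw [hl, List.take_take, min_eq_left (by omega)] at hR
    exact hR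
  · intro a
    rw [h]
    constructor
    · rintro ⟨s, hs⟩
      exact ⟨s, s, by simp, by rwa [take_pre_of_le Z le_rfl]⟩
    · rintro ⟨s, k, hk, hs⟩
      rw [length_pre] at hk
      rw [take_pre_of_le Z (by omega)] at hs
      exact ⟨k, hs⟩

theorem of_primrec {p : β → Prop} (hp : PrimrecPred p) : Sig Z p :=
  ⟨fun a _ => p a, by fun_prop, fun _ _ _ _ h => h, fun a => by simp⟩

theorem comp {p : β → Prop} (hp : Sig Z p) {f : α → β} (hf : Primrec f) :
    Sig Z fun a => p (f a) := by
  obtain ⟨R, hR, hm, h⟩ := hp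
  refine ⟨fun a l => R (f a) l, ?_, fun a => hm (f a), fun a => h (f a)⟩
  exact hR.comp (f := fun x : α × List Bool => (f x.1, x.2)) (by fun_prop)

theorem and {p q : β → Prop} (hp : Sig Z p) (hq : Sig Z q) : Sig Z fun a => p a ∧ q a := by
  obtain ⟨R, hR, hm, h⟩ := hp
  obtain ⟨R', hR', hm', h'⟩ := hq
  refine ⟨fun a l => R a l ∧ R' a l, hR.and hR',
    fun a l l' hl hh => ⟨hm _ _ _ hl hh.1, hm' _ _ _ hl hh.2⟩, fun a => ?_⟩
  change (p a ∧ q a) ↔ ∃ s, R a (pre Z s) ∧ R' a (pre Z s)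
  rw [h, h']
  constructor
  · rintro ⟨⟨s, hs⟩, t, ht⟩
    exact ⟨max s t, hm _ _ _ (pre_prefix Z (le_max_left _ _)) hs,
      hm' _ _ _ (pre_prefix Z (le_max_right _ _)) ht⟩
  · rintro ⟨s, h1, h2⟩
    exact ⟨⟨s, h1⟩, s, h2⟩

theorem or {p q : β → Prop} (hp : Sig Z p) (hq : Sig Z q) : Sig Z fun a => p a ∨ q a := by
  obtain ⟨R, hR, hm, h⟩ := hp
  obtain ⟨R', hR', hm', h'⟩ := hq
  refine ⟨fun a l => R a l ∨ R' a l, hR.or hR',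
    fun a l l' hl hh => hh.imp (hm _ _ _ hl) (hm' _ _ _ hl), fun a => ?_⟩
  change (p a ∨ q a) ↔ ∃ s, R a (pre Z s) ∨ R' a (pre Z s)
  rw [h, h', exists_or]

theorem imp {p q : β → Prop} (hp : PrimrecPred p) (hq : Sig Z q) : Sig Z fun a => p a → q a :=
  ((of_primrec hp.not).or hq).of_eq fun a => by tauto

theorem exists_nat {p : β × ℕ → Prop} (hp : Sig Z p) : Sig Z fun a => ∃ n, p (a, n) := by
  obtain ⟨R, hR, hm, h⟩ := hp
  refine ⟨fun a l => ∃ n < l.length, R (a, n) l, ?_, ?_, fun a => ?_⟩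
  · have := hR.comp (f := fun x : (β × List Bool) × ℕ => ((x.1.1, x.2), x.1.2)) (by fun_prop)
    exact primrecPred_exists_lt (by fun_prop) this
  · rintro a l l' hl ⟨n, hn, hh⟩
    exact ⟨n, hn.trans_le hl.length_le, hm _ _ _ hl hh⟩
  · simp only [h]
    constructor
    · rintro ⟨n, s, hs⟩
      exact ⟨max (n + 1) s, n, by simp, hm _ _ _ (pre_prefix Z (le_max_right _ _)) hs⟩
    · rintro ⟨s, n, -, hs⟩
      exact ⟨n, s, hs⟩

/-- Closure of `Sig` under unbounded existential quantification. -/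
theorem ex {p : β → γ → Prop} (hp : Sig Z fun x : β × γ => p x.1 x.2) :
    Sig Z fun a => ∃ c, p a c := by
  classical
  by_cases hγ : Nonempty γ
  · obtain ⟨d⟩ := hγ
    have := (hp.comp (f := fun x : β × ℕ => (x.1, (Encodable.decode x.2).getD d))
      (by fun_prop)).exists_nat
    refine this.of_eq fun a => ⟨fun ⟨n, hn⟩ => ⟨_, hn⟩, fun ⟨c, hc⟩ => ⟨Encodable.encode c, ?_⟩⟩
    simpa using hc
  · refine (of_primrec (primrecPred_const False)).of_eq fun a => ?_
    simp only [false_iff, not_exists]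
    exact fun c => (hγ ⟨c⟩).elim

theorem ex' {p : β × γ → Prop} (hp : Sig Z p) : Sig Z fun a => ∃ c, p (a, c) :=
  ex (p := fun a c => p (a, c)) hp

theorem forall_mem {f : β → List γ} {p : β → γ → Prop} (hf : Primrec f)
    (hp : Sig Z fun x : β × γ => p x.1 x.2) : Sig Z fun a => ∀ c ∈ f a, p a c := by
  obtain ⟨R, hR, hm, h⟩ := hp
  refine ⟨fun a l => ∀ c ∈ f a, R (a, c) l, ?_, fun a l l' hl hh c hc => hm _ _ _ hl (hh c hc),
    fun a => ?_⟩
  · have := hR.comp (f := fun x : (β × List Bool) × γ => ((x.1.1, x.2), x.1.2)) (by fun_prop)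
    exact primrecPred_forall_mem (by fun_prop) this
  · have h' : ∀ c, p a c ↔ ∃ s, R (a, c) (pre Z s) := fun c => h (a, c)
    simp only [h']
    generalize f a = L
    induction L with
    | nil => simp
    | cons c L ih =>
      simp only [List.forall_mem_cons, ih]
      constructor
      · rintro ⟨⟨s, hs⟩, t, ht⟩
        exact ⟨max s t, hm _ _ _ (pre_prefix Z (le_max_left _ _)) hs, fun c hc =>
          hm _ _ _ (pre_prefix Z (le_max_right _ _)) (ht c hc)⟩
      · rintro ⟨s, h1, h2⟩
        exact ⟨⟨s, h1⟩, s, h2⟩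

theorem forall_lt {f : β → ℕ} {p : β → ℕ → Prop} (hf : Primrec f)
    (hp : Sig Z fun x : β × ℕ => p x.1 x.2) : Sig Z fun a => ∀ n < f a, p a n :=
  (forall_mem (Primrec.list_range.comp hf) hp).of_eq fun a => by simp

attribute [fun_prop] Sig of_primrec comp and or imp ex forall_mem forall_lt

end Sig

section Codes

/-- The characteristic function of a set of naturals, as a point of Cantor space. -/
noncomputable def chr (A : Set ℕ) : ℕ → Bool :=
  open Classical in fun n => decide (n ∈ A)

theorem chi_eq (A : Set ℕ) (n : ℕ) : chi A n = if chr A n then 1 else 0 := by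
  classical
  simp [chi, chr, Set.indicator_apply]

theorem chr_empty : chr ∅ = fun _ => false := by
  funext n
  simp [chr]

theorem Sig.oracle {Z : ℕ → Bool} : Sig Z fun x : ℕ => Z x = true := by
  refine ⟨fun x l => l[x]? = some true, by fun_prop, ?_, fun x => ⟨fun h => ⟨x + 1, ?_⟩, ?_⟩⟩
  · rintro x l l' ⟨t, rfl⟩ h
    rw [List.getElem?_append_left (List.getElem?_eq_some_iff.1 h).1, h]
  · exact (getElem?_pre Z (Nat.lt_succ_self x)).trans (congrArg some h)
  · rintro ⟨s, hs⟩
    obtain ⟨h1, h2⟩ := List.getElem?_eq_some_iff.1 hs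
    simpa using h2

theorem Sig.oracle_not {Z : ℕ → Bool} : Sig Z fun x : ℕ => Z x = false := by
  refine ⟨fun x l => l[x]? = some false, by fun_prop, ?_, fun x => ⟨fun h => ⟨x + 1, ?_⟩, ?_⟩⟩
  · rintro x l l' ⟨t, rfl⟩ h
    rw [List.getElem?_append_left (List.getElem?_eq_some_iff.1 h).1, h]
  · exact (getElem?_pre Z (Nat.lt_succ_self x)).trans (congrArg some h)
  · rintro ⟨s, hs⟩
    obtain ⟨h1, h2⟩ := List.getElem?_eq_some_iff.1 hs
    simpa using h2

theorem mem_prec_iff {f : ℕ →. ℕ} {g : ℕ → ℕ →. ℕ} {a n y : ℕ} :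
    y ∈ (Nat.rec (f a) (fun i IH => IH.bind fun v => g i v) n : Part ℕ) ↔
      ∃ L : List ℕ, (L[0]?).getD 0 ∈ f a ∧
        (∀ i < n, (L[i + 1]?).getD 0 ∈ g i ((L[i]?).getD 0)) ∧ y = (L[n]?).getD 0 := by
  constructor
  · suffices H : y ∈ (Nat.rec (f a) (fun i IH => IH.bind fun v => g i v) n : Part ℕ) →
        ∃ L : List ℕ, L.length = n + 1 ∧ (L[0]?).getD 0 ∈ f a ∧
        (∀ i < n, (L[i + 1]?).getD 0 ∈ g i ((L[i]?).getD 0)) ∧ y = (L[n]?).getD 0 from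
      fun h => let ⟨L, _, h⟩ := H h; ⟨L, h⟩
    induction n generalizing y with
    | zero => exact fun h => ⟨[y], rfl, by simpa using h, by simp, by simp⟩
    | succ n ih =>
      intro h
      obtain ⟨v, hv, hy⟩ := Part.mem_bind_iff.1 h
      obtain ⟨L, hL, h0, hs, rfl⟩ := ih hv
      refine ⟨L ++ [y], by simp [hL], ?_, fun i hi => ?_, by simp [← hL]⟩
      · rwa [List.getElem?_append_left (by omega)]
      · rw [List.getElem?_append_left (i := i) (by omega)]
        rcases Nat.lt_succ_iff_lt_or_eq.1 hi with h' | rfl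
        · rw [List.getElem?_append_left (by omega)]
          exact hs i h'
        · simpa [← hL] using hy
  · rintro ⟨L, h0, hs, rfl⟩
    induction n with
    | zero => exact h0
    | succ n ih =>
      exact Part.mem_bind_iff.2 ⟨_, ih fun i hi => hs i (by omega), hs n (by omega)⟩

theorem OracleCode.eval_pair (O : ℕ → ℕ) (cf cg : OracleCode) (n : ℕ) :
    (pair cf cg).eval O n =
      (cf.eval O n).bind fun u => (cg.eval O n).map fun v => Nat.pair u v := by
  simp [eval, Seq.seq, Part.bind_map]

theorem OracleCode.eval_comp (O : ℕ → ℕ) (cf cg : OracleCode) (n : ℕ) :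
    (comp cf cg).eval O n = (cg.eval O n).bind fun u => cf.eval O u := rfl

theorem OracleCode.eval_primRec (O : ℕ → ℕ) (cf cg : OracleCode) (n : ℕ) :
    (prec cf cg).eval O n = (Nat.rec (cf.eval O n.unpair.1) (fun i IH => IH.bind fun v =>
      cg.eval O (Nat.pair n.unpair.1 (Nat.pair i v))) n.unpair.2 : Part ℕ) := rfl

theorem OracleCode.eval_rfind' (O : ℕ → ℕ) (cf : OracleCode) (n : ℕ) :
    (rfind' cf).eval O n = (Nat.rfind fun k => (cf.eval O (Nat.pair n.unpair.1
      (k + n.unpair.2))).map fun m => decide (m = 0)).map (· + n.unpair.2) := rfl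

theorem OracleCode.sig_eval (A : Set ℕ) (c : OracleCode) :
    Sig (chr A) fun x : ℕ × ℕ => x.2 ∈ c.eval (chi A) x.1 := by
  induction c with
  | zero =>
    have : PrimrecPred fun x : ℕ × ℕ => x.2 = 0 := by fun_prop
    exact (Sig.of_primrec this).of_eq fun x => by simp [eval, pure, PFun.pure]
  | succ =>
    have : PrimrecPred fun x : ℕ × ℕ => x.2 = x.1 + 1 := by fun_prop
    exact (Sig.of_primrec this).of_eq fun x => by simp [eval]
  | left =>
    have : PrimrecPred fun x : ℕ × ℕ => x.2 = x.1.unpair.1 := by fun_prop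
    exact (Sig.of_primrec this).of_eq fun x => by simp [eval]
  | right =>
    have : PrimrecPred fun x : ℕ × ℕ => x.2 = x.1.unpair.2 := by fun_prop
    exact (Sig.of_primrec this).of_eq fun x => by simp [eval]
  | oracle =>
    have h1 := (Sig.oracle (Z := chr A)).comp (Primrec.fst (α := ℕ) (β := ℕ))
    have h2 := (Sig.oracle_not (Z := chr A)).comp (Primrec.fst (α := ℕ) (β := ℕ))
    have e1 : PrimrecPred fun x : ℕ × ℕ => x.2 = 1 := by fun_prop
    have e2 : PrimrecPred fun x : ℕ × ℕ => x.2 = 0 := by fun_prop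
    refine ((h1.and (Sig.of_primrec e1)).or (h2.and (Sig.of_primrec e2))).of_eq fun x => ?_
    simp only [eval, PFun.coe_val, Part.mem_some_iff, chi_eq]
    cases chr A x.1 <;> simp
  | pair cf cg hf hg =>
    have h1 := hf.comp (f := fun x : (ℕ × ℕ) × ℕ × ℕ => (x.1.1, x.2.1)) (by fun_prop)
    have h2 := hg.comp (f := fun x : (ℕ × ℕ) × ℕ × ℕ => (x.1.1, x.2.2)) (by fun_prop)
    have h3 : PrimrecPred fun x : (ℕ × ℕ) × ℕ × ℕ => x.1.2 = Nat.pair x.2.1 x.2.2 := by fun_prop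
    refine ((h1.and h2).and (Sig.of_primrec h3)).ex'.of_eq fun x => ?_
    simp only [eval_pair, Part.mem_bind_iff, Part.mem_map_iff]
    constructor
    · rintro ⟨⟨u, v⟩, ⟨hu, hv⟩, h⟩
      exact ⟨u, hu, v, hv, h.symm⟩
    · rintro ⟨u, hu, v, hv, h⟩
      exact ⟨⟨u, v⟩, ⟨hu, hv⟩, h.symm⟩
  | comp cf cg hf hg =>
    have h1 := hg.comp (f := fun x : (ℕ × ℕ) × ℕ => (x.1.1, x.2)) (by fun_prop)
    have h2 := hf.comp (f := fun x : (ℕ × ℕ) × ℕ => (x.2, x.1.2)) (by fun_prop)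
    refine (h1.and h2).ex'.of_eq fun x => ?_
    simp only [eval_comp, Part.mem_bind_iff]
  | prec cf cg hf hg =>
    have h1 := hf.comp (f := fun x : (ℕ × ℕ) × List ℕ => (x.1.1.unpair.1, (x.2[0]?).getD 0))
      (by fun_prop)
    have h2 := hg.comp (f := fun x : ((ℕ × ℕ) × List ℕ) × ℕ =>
      (Nat.pair x.1.1.1.unpair.1 (Nat.pair x.2 ((x.1.2[x.2]?).getD 0)),
        (x.1.2[x.2 + 1]?).getD 0)) (by fun_prop)
    have h2' := Sig.forall_lt (f := fun x : (ℕ × ℕ) × List ℕ => x.1.1.unpair.2)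
      (p := fun x i => (x.2[i + 1]?).getD 0 ∈
        cg.eval (chi A) (Nat.pair x.1.1.unpair.1 (Nat.pair i ((x.2[i]?).getD 0))))
      (by fun_prop) h2
    have h3 : PrimrecPred fun x : (ℕ × ℕ) × List ℕ =>
      x.1.2 = (x.2[x.1.1.unpair.2]?).getD 0 := by fun_prop
    refine (h1.and (h2'.and (Sig.of_primrec h3))).ex'.of_eq fun x => ?_
    rw [eval_primRec]
    exact (mem_prec_iff (f := cf.eval (chi A)) (a := x.1.unpair.1) (n := x.1.unpair.2) (y := x.2)
      (g := fun i v => cg.eval (chi A) (Nat.pair x.1.unpair.1 (Nat.pair i v)))).symm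
  | rfind' cf hf =>
    have h1 : PrimrecPred fun x : ℕ × ℕ => x.1.unpair.2 ≤ x.2 := by fun_prop
    have h2 := hf.comp (f := fun x : ℕ × ℕ => (Nat.pair x.1.unpair.1 x.2, 0)) (by fun_prop)
    have h3 := hf.comp (f := fun x : ((ℕ × ℕ) × ℕ) × ℕ =>
      (Nat.pair x.1.1.1.unpair.1 (x.1.2 + x.1.1.1.unpair.2), x.2)) (by fun_prop)
    have h4 : PrimrecPred fun x : ((ℕ × ℕ) × ℕ) × ℕ => x.2 ≠ 0 := by fun_prop
    have h5 := (h3.and (Sig.of_primrec h4)).ex'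
    have h6 := Sig.forall_lt (f := fun x : ℕ × ℕ => x.2 - x.1.unpair.2)
      (p := fun x j => ∃ v, v ∈ cf.eval (chi A) (Nat.pair x.1.unpair.1 (j + x.1.unpair.2)) ∧
        v ≠ 0) (by fun_prop) h5
    refine ((Sig.of_primrec h1).and (h2.and h6)).of_eq fun x => ?_
    rw [eval_rfind', Part.mem_map_iff]
    constructor
    · rintro ⟨hle, h0, hj⟩
      refine ⟨x.2 - x.1.unpair.2, Nat.mem_rfind.2 ⟨?_, fun {j} hj' => ?_⟩,
        Nat.sub_add_cancel hle⟩
      · rw [Nat.sub_add_cancel hle]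
        exact Part.mem_map_iff _ |>.2 ⟨0, h0, by simp⟩
      · obtain ⟨v, hv, hne⟩ := hj j hj'
        exact Part.mem_map_iff _ |>.2 ⟨v, hv, by simpa using hne⟩
    · rintro ⟨n, hn, hx⟩
      obtain ⟨h0, hn⟩ := Nat.mem_rfind.1 hn
      obtain ⟨v, hv, hv0⟩ := (Part.mem_map_iff _).1 h0
      obtain rfl : v = 0 := by simpa using hv0
      refine ⟨by omega, ?_, fun j hj => ?_⟩
      · rw [← hx]
        exact hv
      · obtain ⟨v, hv, hne⟩ := (Part.mem_map_iff _).1 (hn (m := j) (by omega))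
        exact ⟨v, hv, by simpa using hne⟩

/-- The code `c` computes the total function `f` from the oracle `O`. -/
def OracleCode.Computes (O : ℕ → ℕ) (c : OracleCode) (f : ℕ → ℕ) : Prop :=
  ∀ n, c.eval O n = Part.some (f n)

theorem OracleCode.computes_pair {O : ℕ → ℕ} {cf cg : OracleCode} {f g : ℕ → ℕ}
    (hf : cf.Computes O f) (hg : cg.Computes O g) :
    (pair cf cg).Computes O fun n => Nat.pair (f n) (g n) := by
  intro n
  rw [eval_pair, hf, hg, Part.bind_some, Part.map_some]

theorem OracleCode.computes_comp {O : ℕ → ℕ} {cf cg : OracleCode} {f g : ℕ → ℕ}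
    (hf : cf.Computes O f) (hg : cg.Computes O g) :
    (comp cf cg).Computes O fun n => f (g n) := by
  intro n
  rw [eval_comp, hg, Part.bind_some, hf]

theorem OracleCode.computes_prec {O : ℕ → ℕ} {cf cg : OracleCode} {f g : ℕ → ℕ}
    (hf : cf.Computes O f) (hg : cg.Computes O g) :
    (prec cf cg).Computes O (Nat.unpaired fun z n =>
      n.rec (f z) fun y IH => g (Nat.pair z (Nat.pair y IH))) := by
  intro n
  rw [eval_primRec, Nat.unpaired]
  induction n.unpair.2 with
  | zero => exact hf _
  | succ k ih =>
    refine (congrArg (Part.bind · _) ih).trans ?_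
    rw [Part.bind_some, hg]

theorem OracleCode.exists_computes {f : ℕ → ℕ} (hf : Nat.Primrec f) (O : ℕ → ℕ) :
    ∃ c : OracleCode, c.Computes O f := by
  induction hf with
  | zero => exact ⟨.zero, fun n => rfl⟩
  | succ => exact ⟨.succ, fun n => rfl⟩
  | left => exact ⟨.left, fun n => rfl⟩
  | right => exact ⟨.right, fun n => rfl⟩
  | pair _ _ hf hg =>
    obtain ⟨cf, hf⟩ := hf
    obtain ⟨cg, hg⟩ := hg
    exact ⟨_, computes_pair hf hg⟩
  | comp _ _ hf hg =>
    obtain ⟨cf, hf⟩ := hf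
    obtain ⟨cg, hg⟩ := hg
    exact ⟨_, computes_comp hf hg⟩
  | prec _ _ hf hg =>
    obtain ⟨cf, hf⟩ := hf
    obtain ⟨cg, hg⟩ := hg
    exact ⟨_, computes_prec hf hg⟩

theorem OracleCode.exists_computes_pre (A : Set ℕ) :
    ∃ c : OracleCode, c.Computes (chi A)
      fun n => Encodable.encode (pre (chr A) n.unpair.2) := by
  have hF : Primrec fun n : ℕ => Encodable.encode
      (((Encodable.decode n.unpair.1 : Option (List Bool)).getD []) ++
        [decide (n.unpair.2 = 1)]) := by
    fun_prop
  obtain ⟨cF, hF⟩ := exists_computes (Primrec.nat_iff.1 hF) (chi A)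
  obtain ⟨c0, h0⟩ := exists_computes
    (Primrec.nat_iff.1 (Primrec.const (Encodable.encode ([] : List Bool)))) (chi A)
  have hl : left.Computes (chi A) fun n => n.unpair.1 := fun n => rfl
  have hr : right.Computes (chi A) fun n => n.unpair.2 := fun n => rfl
  have ho : OracleCode.oracle.Computes (chi A) (chi A) := fun n => rfl
  have hg := computes_comp hF (computes_pair (computes_comp hr hr)
    (computes_comp ho (computes_comp hl hr)))
  refine ⟨_, fun n => (computes_prec h0 hg n).trans ?_⟩
  congr 1
  simp only [Nat.unpaired]
  induction n.unpair.2 with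
  | zero => rfl
  | succ k ih =>
    simp only [ih]
    simp only [Nat.unpair_pair, Encodable.encodek, pre_succ, chi_eq, Option.getD_some]
    cases chr A k <;> simp

theorem Sig.exists_code {A : Set ℕ} {β : Type*} [Primcodable β] {p : β → Prop}
    (hp : Sig (chr A) p) :
    ∃ c : OracleCode, ∀ x, p x ↔ (c.eval (chi A) (Encodable.encode x)).Dom := by
  classical
  obtain ⟨R, hR, -, h⟩ := hp
  by_cases hβ : Nonempty β
  swap
  · exact ⟨.zero, fun x => (hβ ⟨x⟩).elim⟩
  obtain ⟨d⟩ := hβ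
  have hF : Primrec fun n : ℕ => if R ((Encodable.decode n.unpair.1).getD d)
      ((Encodable.decode n.unpair.2).getD []) then 0 else 1 := by
    have := hR.comp (f := fun n : ℕ => ((Encodable.decode n.unpair.1 : Option β).getD d,
      (Encodable.decode n.unpair.2 : Option (List Bool)).getD [])) (by fun_prop)
    exact Primrec.ite this (by fun_prop) (by fun_prop)
  obtain ⟨cF, hF⟩ := OracleCode.exists_computes (Primrec.nat_iff.1 hF) (chi A)
  obtain ⟨cp, hcp⟩ := OracleCode.exists_computes_pre A
  have hl : OracleCode.left.Computes (chi A) fun n => n.unpair.1 := fun n => rfl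
  have hr : OracleCode.right.Computes (chi A) fun n => n.unpair.2 := fun n => rfl
  have hz : OracleCode.zero.Computes (chi A) fun _ => 0 := fun n => rfl
  have hc := OracleCode.computes_comp hF (OracleCode.computes_pair hl hcp)
  have hid := OracleCode.computes_pair (OracleCode.computes_pair hl hr) hz
  refine ⟨.comp (.rfind' (.comp cF (.pair .left cp))) (.pair (.pair .left .right) .zero),
    fun x => ?_⟩
  have key : ∀ k, ((OracleCode.comp cF (.pair .left cp)).eval (chi A)
      (Nat.pair (Nat.pair (Nat.pair (Encodable.encode x).unpair.1 (Encodable.encode x).unpair.2)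
        0).unpair.1 (k + (Nat.pair (Nat.pair (Encodable.encode x).unpair.1
          (Encodable.encode x).unpair.2) 0).unpair.2))).map (fun m => decide (m = 0)) =
      Part.some (decide (R x (pre (chr A) k))) := by
    intro k
    rw [hc, Part.map_some]
    congr 1
    simp
  rw [h, OracleCode.eval_comp, hid, Part.bind_some, OracleCode.eval_rfind', Part.map_Dom]
  refine Iff.trans ?_ Nat.rfind_dom.symm
  constructor
  · rintro ⟨s, hs⟩
    exact ⟨s, (congrArg (true ∈ ·) (key s)).mpr (by simpa using hs), fun {m} _ =>
      (congrArg Part.Dom (key m)).mpr trivial⟩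
  · rintro ⟨s, hs, -⟩
    have := (congrArg (true ∈ ·) (key s)).mp hs
    exact ⟨s, by simpa using this⟩

theorem ceSeqIn_iff {A : Set ℕ} {W : ℕ → Set (List Bool)} :
    CeSeqIn A W ↔ Sig (chr A) fun x : ℕ × List Bool => x.2 ∈ W x.1 := by
  constructor
  · rintro ⟨c, hc⟩
    have := (c.sig_eval A).comp (f := fun x : (ℕ × List Bool) × ℕ =>
      (Nat.pair x.1.1 (Encodable.encode x.1.2), x.2)) (by fun_prop)
    refine this.ex'.of_eq fun x => ?_
    rw [hc, Part.dom_iff_mem]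
  · intro h
    obtain ⟨c, hc⟩ := h.exists_code
    exact ⟨c, fun n σ => hc (n, σ)⟩

end Codes

section Strings

/-- The list of all binary strings of length `n`. -/
def strs : ℕ → List (List Bool)
  | 0 => [[]]
  | n + 1 => (strs n).flatMap fun σ => [σ ++ [false], σ ++ [true]]

@[simp] theorem mem_strs {n : ℕ} {σ : List Bool} : σ ∈ strs n ↔ σ.length = n := by
  induction n generalizing σ with
  | zero => simp [strs, List.length_eq_zero_iff]
  | succ n ih =>
    simp only [strs, List.mem_flatMap, ih, List.mem_cons, List.not_mem_nil, or_false]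
    constructor
    · rintro ⟨τ, rfl, rfl | rfl⟩ <;> simp
    · intro h
      obtain ⟨τ, b, rfl⟩ : ∃ τ b, σ = τ ++ [b] := by
        have : σ ≠ [] := by rintro rfl; simp at h
        exact ⟨σ.dropLast, σ.getLast this, (List.dropLast_append_getLast this).symm⟩
      refine ⟨τ, by simpa using h, ?_⟩
      cases b <;> simp

@[fun_prop]
theorem primrec_strs {α : Type*} [Primcodable α] {f : α → ℕ} (hf : Primrec f) :
    Primrec fun a => strs (f a) := by
  have h : Primrec fun a => (Nat.rec [[]]
      (fun _ s => s.flatMap fun σ => [σ ++ [false], σ ++ [true]]) (f a) :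
        List (List Bool)) := by
    fun_prop
  refine h.of_eq fun a => ?_
  induction f a with
  | zero => rfl
  | succ n ih => rw [strs, ← ih]

end Strings

section Measure

open scoped ENNReal

/-- The basic open set of all sequences extending `σ`. -/
def N (σ : List Bool) : Set (ℕ → Bool) := {X | pre X σ.length = σ}

theorem mem_N {X : ℕ → Bool} {σ : List Bool} : X ∈ N σ ↔ pre X σ.length = σ := Iff.rfl

theorem mem_N_pre (X : ℕ → Bool) (n : ℕ) : X ∈ N (pre X n) := by simp [mem_N]

theorem N_eq_iInter (σ : List Bool) :
    N σ = ⋂ i : Fin σ.length, (fun X : ℕ → Bool => X i) ⁻¹' {σ[i]} := by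
  ext X
  simp only [mem_N, pre_eq_iff, Set.mem_iInter, Set.mem_preimage, Set.mem_singleton_iff]
  exact ⟨fun h i => h.2 i i.2, fun h => ⟨trivial, fun i hi => h ⟨i, hi⟩⟩⟩

theorem measurableSet_N (σ : List Bool) : MeasurableSet (N σ) := by
  rw [N_eq_iInter]
  exact MeasurableSet.iInter fun i => measurable_pi_apply _ (measurableSet_singleton _)

theorem isOpen_N (σ : List Bool) : IsOpen (N σ) := by
  rw [N_eq_iInter]
  exact isOpen_iInter_of_finite fun i => (continuous_apply _).isOpen_preimage _
    (isOpen_discrete _)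

theorem Cyl_eq_iUnion (W : Set (List Bool)) : Cyl W = ⋃ σ ∈ W, N σ := by
  ext X
  simp only [mem_Cyl, Set.mem_iUnion, exists_prop]
  exact ⟨fun ⟨n, h⟩ => ⟨_, h, mem_N_pre X n⟩, fun ⟨σ, h, hX⟩ => ⟨σ.length, by
    rwa [mem_N.1 hX]⟩⟩

theorem measurableSet_Cyl (W : Set (List Bool)) : MeasurableSet (Cyl W) := by
  rw [Cyl_eq_iUnion]
  exact MeasurableSet.biUnion W.to_countable fun σ _ => measurableSet_N σ

theorem isOpen_Cyl (W : Set (List Bool)) : IsOpen (Cyl W) := by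
  rw [Cyl_eq_iUnion]
  exact isOpen_biUnion fun σ _ => isOpen_N σ

theorem N_subset_N {σ τ : List Bool} (h : σ <+: τ) : N τ ⊆ N σ := by
  intro X hX
  rw [mem_N] at hX
  rw [← hX] at h
  exact (eq_pre_of_prefix h).symm

theorem prefix_of_mem_N {X : ℕ → Bool} {σ τ : List Bool} (h1 : X ∈ N σ) (h2 : X ∈ N τ)
    (h : σ.length ≤ τ.length) : σ <+: τ := by
  rw [← mem_N.1 h1, ← mem_N.1 h2]
  exact pre_prefix X h

theorem ext_of_N {μ ν : Measure (ℕ → Bool)} [IsFiniteMeasure μ] (h : ∀ σ, μ (N σ) = ν (N σ)) :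
    μ = ν := by
  have hN : N [] = Set.univ := by
    ext X
    simp [mem_N]
  refine ext_of_generate_finite (Set.range N) ?_ ?_ ?_ (by rw [← hN, h])
  · apply le_antisymm
    · refine iSup_le fun n => ?_
      rw [← measurable_iff_comap_le]
      intro S _
      have : (fun X : ℕ → Bool => X n) ⁻¹' S = ⋃ σ ∈ {σ : List Bool | ∃ h : n < σ.length, σ[n] ∈ S},
          N σ := by
        ext X
        simp only [Set.mem_preimage, Set.mem_iUnion, Set.mem_ofPred_eq]
        constructor
        · intro h
          exact ⟨pre X (n + 1), ⟨by simp, by simpa using h⟩, mem_N_pre _ _⟩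
        · rintro ⟨σ, ⟨h, hS⟩, hX⟩
          rwa [(pre_eq_iff.1 hX).2 n h]
      rw [this]
      refine MeasurableSet.biUnion (Set.to_countable _) fun σ _ =>
        MeasurableSpace.measurableSet_generateFrom ⟨σ, rfl⟩
    · refine MeasurableSpace.generateFrom_le ?_
      rintro _ ⟨σ, rfl⟩
      exact measurableSet_N σ
  · rintro _ ⟨σ, rfl⟩ _ ⟨τ, rfl⟩ ⟨X, h1, h2⟩
    rcases le_total σ.length τ.length with h | h
    · exact ⟨τ, (Set.inter_eq_right.2 (N_subset_N (prefix_of_mem_N h1 h2 h))).symm⟩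
    · exact ⟨σ, (Set.inter_eq_left.2 (N_subset_N (prefix_of_mem_N h2 h1 h))).symm⟩
  · rintro _ ⟨σ, rfl⟩
    exact h σ

/-- The number whose binary expansion (most significant bit first) is `σ`. -/
def binVal (σ : List Bool) : ℕ := σ.foldl (fun v b => 2 * v + b.toNat) 0

theorem binVal_append (σ : List Bool) (b : Bool) :
    binVal (σ ++ [b]) = 2 * binVal σ + b.toNat := by
  simp [binVal]

theorem binVal_lt (σ : List Bool) : binVal σ < 2 ^ σ.length := by
  induction σ using List.reverseRecOn with
  | nil => simp [binVal]
  | append_singleton σ b ih =>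
    rw [binVal_append, List.length_append, List.length_singleton, pow_succ]
    have := b.toNat_le
    omega

theorem binVal_inj {σ τ : List Bool} (h : σ.length = τ.length) (hv : binVal σ = binVal τ) :
    σ = τ := by
  induction σ using List.reverseRecOn generalizing τ with
  | nil => simpa using h.symm
  | append_singleton σ b ih =>
    induction τ using List.reverseRecOn with
    | nil => simp at h
    | append_singleton τ c _ =>
      rw [binVal_append, binVal_append] at hv
      have hb := b.toNat_le
      have hc := c.toNat_le
      rw [ih (τ := τ) (by simpa using h) (by omega)]
      have : b.toNat = c.toNat := by omega
      cases b <;> cases c <;> simp_all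

/-- The binary expansion of a real number in `[0, 1)`. -/
noncomputable def binExp (x : ℝ) (n : ℕ) : Bool := decide (⌊x * 2 ^ (n + 1)⌋₊ % 2 = 1)

theorem mu_eq : mu = Measure.map binExp (volume.restrict (Set.Ico (0 : ℝ) 1)) := rfl

theorem measurable_binExp : Measurable binExp := by
  refine measurable_pi_iff.2 fun n => ?_
  exact (measurable_from_nat (f := fun k : ℕ => decide (k % 2 = 1))).comp
    (Nat.measurable_floor.comp (measurable_id.mul_const _))

theorem binVal_pre_binExp {x : ℝ} (h1 : x < 1) (n : ℕ) :
    binVal (pre (binExp x) n) = ⌊x * 2 ^ n⌋₊ := by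
  induction n with
  | zero =>
    rw [pow_zero, mul_one, Nat.floor_eq_zero.2 h1]
    rfl
  | succ n ih =>
    have h : ⌊x * 2 ^ n⌋₊ = ⌊x * 2 ^ (n + 1)⌋₊ / 2 := by
      rw [← Nat.floor_div_ofNat]
      congr 1
      rw [pow_succ]
      field_simp
    rw [pre_succ, binVal_append, ih, h, binExp]
    rcases Nat.mod_two_eq_zero_or_one ⌊x * 2 ^ (n + 1)⌋₊ with h | h <;> simp [h] <;> omega

theorem mu_N (σ : List Bool) : mu (N σ) = 2⁻¹ ^ σ.length := by
  have hpos : (0 : ℝ) < 2 ^ σ.length := by positivity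
  have hlt : (binVal σ : ℝ) + 1 ≤ 2 ^ σ.length := by exact_mod_cast binVal_lt σ
  rw [mu_eq, Measure.map_apply measurable_binExp (measurableSet_N σ),
    Measure.restrict_apply (measurable_binExp (measurableSet_N σ))]
  have : binExp ⁻¹' N σ ∩ Set.Ico 0 1 =
      Set.Ico ((binVal σ : ℝ) / 2 ^ σ.length) ((binVal σ + 1) / 2 ^ σ.length) := by
    ext x
    simp only [Set.mem_inter_iff, Set.mem_preimage, Set.mem_Ico, mem_N, div_le_iff₀ hpos,
      lt_div_iff₀ hpos]
    constructor
    · rintro ⟨h, h0, h1⟩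
      have := binVal_pre_binExp h1 σ.length
      rw [h] at this
      exact (Nat.floor_eq_iff (by positivity)).1 this.symm
    · rintro ⟨h1, h2⟩
      have h0 : 0 ≤ x := by
        by_contra! h
        have : x * 2 ^ σ.length < 0 := mul_neg_of_neg_of_pos h hpos
        have : (0 : ℝ) ≤ binVal σ := by positivity
        linarith
      have hx1 : x < 1 := by
        by_contra! h
        nlinarith
      refine ⟨binVal_inj (by simp) ?_, h0, hx1⟩
      rw [binVal_pre_binExp hx1, Nat.floor_eq_iff (by positivity)]
      exact ⟨h1, h2⟩
  rw [this, Real.volume_Ico, ← sub_div, add_sub_cancel_left, one_div, ← inv_pow,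
    ENNReal.ofReal_pow (by norm_num), ENNReal.ofReal_inv_of_pos (by norm_num)]
  simp

instance : IsProbabilityMeasure mu := by
  refine ⟨?_⟩
  have : N [] = Set.univ := by
    ext X
    simp [mem_N]
  rw [← this, mu_N]
  simp

/-- The sequence `Y` with the string `σ` prepended. -/
def app (σ : List Bool) (Y : ℕ → Bool) (n : ℕ) : Bool :=
  if h : n < σ.length then σ[n] else Y (n - σ.length)

theorem app_add (σ : List Bool) (Y : ℕ → Bool) (n : ℕ) : app σ Y (σ.length + n) = Y n := by
  simp [app]

theorem pre_app (σ : List Bool) (Y : ℕ → Bool) (n : ℕ) :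
    pre (app σ Y) (σ.length + n) = σ ++ pre Y n := by
  rw [pre_eq_iff]
  refine ⟨by simp, fun i h => ?_⟩
  rw [app]
  split_ifs with h1
  · rw [List.getElem_append_left h1]
  · rw [List.getElem_append_right (by omega)]
    simp

@[simp] theorem pre_app_length (σ : List Bool) (Y : ℕ → Bool) :
    pre (app σ Y) σ.length = σ := by
  simpa using pre_app σ Y 0

theorem app_mem_N (σ : List Bool) (Y : ℕ → Bool) : app σ Y ∈ N σ := pre_app_length σ Y

theorem app_append (σ τ : List Bool) (Y : ℕ → Bool) : app (σ ++ τ) Y = app σ (app τ Y) := by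
  funext n
  simp only [app, List.length_append]
  by_cases h1 : n < σ.length
  · simp [h1, List.getElem_append_left, Nat.lt_add_right]
  · by_cases h2 : n - σ.length < τ.length
    · rw [dif_pos (by omega), dif_neg h1, dif_pos h2, List.getElem_append_right (by omega)]
    · rw [dif_neg (by omega), dif_neg h1, dif_neg h2, Nat.sub_add_eq]

@[simp] theorem app_nil (Y : ℕ → Bool) : app [] Y = Y := by
  funext n
  simp [app]

/-- The tail of `X` from position `n` on. -/
def tail (X : ℕ → Bool) (n : ℕ) (i : ℕ) : Bool := X (n + i)

theorem app_tail (X : ℕ → Bool) (n : ℕ) : app (pre X n) (tail X n) = X := by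
  funext i
  simp only [app, length_pre, getElem_pre, tail]
  split_ifs with h
  · rfl
  · congr 1
    omega

theorem mem_N_iff {X : ℕ → Bool} {σ : List Bool} : X ∈ N σ ↔ ∃ Y, X = app σ Y := by
  constructor
  · intro h
    refine ⟨tail X σ.length, ?_⟩
    conv_lhs => rw [← app_tail X σ.length, mem_N.1 h]
  · rintro ⟨Y, rfl⟩
    exact app_mem_N σ Y

theorem measurable_app (σ : List Bool) : Measurable (app σ) := by
  refine measurable_pi_iff.2 fun n => ?_
  by_cases h : n < σ.length
  · simp [app, h]
  · simpa [app, h] using measurable_pi_apply _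

theorem mu_inter_N {E : Set (ℕ → Bool)} (hE : MeasurableSet E) (σ : List Bool) :
    mu (E ∩ N σ) = 2⁻¹ ^ σ.length * mu (app σ ⁻¹' E) := by
  have key : mu.restrict (N σ) = (2⁻¹ ^ σ.length : ℝ≥0∞) • mu.map (app σ) := by
    refine ext_of_N fun τ => ?_
    rw [Measure.restrict_apply (measurableSet_N τ), Measure.smul_apply,
      Measure.map_apply (measurable_app σ) (measurableSet_N τ), smul_eq_mul]
    by_cases h : ∃ Y, app σ Y ∈ N τ
    · obtain ⟨Y, hY⟩ := h
      rcases le_total τ.length σ.length with h | h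
      · have hp := prefix_of_mem_N hY (app_mem_N σ Y) h
        have : app σ ⁻¹' N τ = Set.univ :=
          Set.eq_univ_of_forall fun Z => N_subset_N hp (app_mem_N σ Z)
        rw [Set.inter_eq_right.2 (N_subset_N hp), this, mu_N, measure_univ, mul_one]
      · have hp := prefix_of_mem_N (app_mem_N σ Y) hY h
        obtain ⟨ρ, rfl⟩ := hp
        have : app σ ⁻¹' N (σ ++ ρ) = N ρ := by
          ext Z
          rw [Set.mem_preimage, mem_N, List.length_append, pre_app, mem_N]
          simp
        rw [Set.inter_eq_left.2 (N_subset_N (List.prefix_append σ ρ)), this, mu_N, mu_N,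
          List.length_append, pow_add]
    · push Not at h
      have h1 : app σ ⁻¹' N τ = ∅ := Set.eq_empty_of_forall_notMem h
      have h2 : N τ ∩ N σ = ∅ := by
        refine Set.eq_empty_of_forall_notMem ?_
        rintro X ⟨hX1, hX2⟩
        obtain ⟨Y, rfl⟩ := mem_N_iff.1 hX2
        exact h Y hX1
      simp [h1, h2]
  have := congrArg (· E) key
  simpa [Measure.restrict_apply hE, Measure.map_apply (measurable_app σ) hE] using this

end Measure

section Weights

open scoped ENNReal

/-- The total weight of `S`, where `x` has weight `2 ^ (-g x)`. -/
noncomputable def wt {β : Type*} (g : β → ℕ) (S : Set β) : ℝ≥0∞ := ∑' x : S, 2⁻¹ ^ g x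

theorem wt_mono {β : Type*} {g : β → ℕ} {S T : Set β} (h : S ⊆ T) : wt g S ≤ wt g T :=
  ENNReal.tsum_mono_subtype (fun x => (2⁻¹ : ℝ≥0∞) ^ g x) h

theorem wt_finset {β : Type*} (g : β → ℕ) (S : Finset β) :
    wt g (S : Set β) = ∑ x ∈ S, 2⁻¹ ^ g x :=
  Finset.tsum_subtype S fun x => (2⁻¹ : ℝ≥0∞) ^ g x

/-- A set of strings is prefix-free if no element properly extends another one. -/
def PF (W : Set (List Bool)) : Prop := ∀ σ ∈ W, ∀ τ ∈ W, σ <+: τ → σ = τ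

theorem mu_Cyl_le_wt (W : Set (List Bool)) : mu (Cyl W) ≤ wt List.length W := by
  rw [Cyl_eq_iUnion]
  refine (measure_biUnion_le mu W.to_countable N).trans (le_of_eq ?_)
  exact tsum_congr fun σ => mu_N σ

theorem mu_Cyl_eq_wt {W : Set (List Bool)} (h : PF W) : mu (Cyl W) = wt List.length W := by
  rw [Cyl_eq_iUnion, measure_biUnion W.to_countable ?_ fun σ _ => measurableSet_N σ]
  · exact tsum_congr fun σ => mu_N σ
  · intro σ hσ τ hτ hne
    rw [Function.onFun, Set.disjoint_left]
    intro X h1 h2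
    rcases le_total σ.length τ.length with hl | hl
    · exact hne (h σ hσ τ hτ (prefix_of_mem_N h1 h2 hl))
    · exact hne (h τ hτ σ hσ (prefix_of_mem_N h2 h1 hl)).symm

theorem tsum_encode_le (β : Type*) [Encodable β] :
    ∑' x : β, (2⁻¹ : ℝ≥0∞) ^ (Encodable.encode x + 1) ≤ 1 := by
  refine (ENNReal.tsum_comp_le_tsum_of_injective (Encodable.encode_injective (α := β))
    fun n => (2⁻¹ : ℝ≥0∞) ^ (n + 1)).trans ?_
  rw [ENNReal.tsum_geometric_add_one]
  norm_num

theorem mu_strings {n : ℕ} (L : Finset (List Bool)) (h : ∀ σ ∈ L, σ.length = n) :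
    mu (Cyl (L : Set (List Bool))) = L.card * 2⁻¹ ^ n := by
  rw [mu_Cyl_eq_wt, wt_finset, Finset.sum_congr rfl fun σ hσ => by rw [h σ hσ],
    Finset.sum_const, nsmul_eq_mul]
  intro σ hσ τ hτ hp
  exact hp.eq_of_length (by rw [h σ hσ, h τ hτ])

end Weights

section Tests

open scoped ENNReal

theorem Sig.of_pre {Z : ℕ → Bool} {β : Type*} [Primcodable β] {Q : β → List Bool → Prop}
    (hQ : PrimrecPred fun x : β × List Bool => Q x.1 x.2) {f : β → ℕ} (hf : Primrec f) :
    Sig Z fun b => Q b (pre Z (f b)) := by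
  refine Sig.mk (fun b l => f b ≤ l.length ∧ Q b (l.take (f b))) ?_ fun b => ?_
  · have := hQ.comp (f := fun x : β × List Bool => (x.1, x.2.take (f x.1))) (by fun_prop)
    exact PrimrecPred.and (by fun_prop) this
  · constructor
    · exact fun h => ⟨f b, by simp, by rwa [take_pre_of_le Z le_rfl]⟩
    · rintro ⟨s, h1, h2⟩
      rw [length_pre] at h1
      rwa [take_pre_of_le Z h1] at h2

/-- Every uniformly c.e. sequence of open sets is generated by a uniformly primitive recursive
sequence of prefix-free sets. -/
theorem exists_prefixFree {Z : ℕ → Bool} {γ : Type*} [Primcodable γ] {W : γ → Set (List Bool)}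
    (hW : Sig Z fun x : γ × List Bool => x.2 ∈ W x.1) :
    ∃ Q : γ → List Bool → List Bool → Prop,
      (PrimrecPred fun x : (γ × List Bool) × List Bool => Q x.1.1 x.1.2 x.2) ∧
      ∀ n, PF {σ | Q n σ (pre Z σ.length)} ∧ Cyl {σ | Q n σ (pre Z σ.length)} = Cyl (W n) := by
  obtain ⟨R, hR, hm, h⟩ := hW
  let M : γ → List Bool → List Bool → Prop := fun n σ α =>
    ∃ k < σ.length + 1, R (n, σ.take k) α
  have hM : PrimrecPred fun x : (γ × List Bool) × List Bool => M x.1.1 x.1.2 x.2 := by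
    have := hR.comp (f := fun x : ((γ × List Bool) × List Bool) × ℕ =>
      ((x.1.1.1, x.1.1.2.take x.2), x.1.2)) (by fun_prop)
    exact primrecPred_exists_lt (by fun_prop) this
  refine ⟨fun n σ α => M n σ α ∧ ∀ k < σ.length, ¬ M n (σ.take k) (α.take k), ?_, fun n => ⟨?_, ?_⟩⟩
  · have := hM.comp (f := fun x : ((γ × List Bool) × List Bool) × ℕ =>
      ((x.1.1.1, x.1.1.2.take x.2), x.1.2.take x.2)) (by fun_prop)
    exact hM.and (primrecPred_forall_lt (by fun_prop) this.not)
  · rintro σ ⟨h1, -⟩ τ ⟨-, h2⟩ hp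
    refine hp.eq_of_length (le_antisymm hp.length_le ?_)
    by_contra! hlt
    apply h2 _ hlt
    rwa [take_pre_of_le Z hlt.le, ← List.prefix_iff_eq_take.1 hp]
  · ext X
    rw [mem_Cyl, mem_Cyl]
    constructor
    · rintro ⟨m, ⟨k, hk, hh⟩, -⟩
      rw [length_pre] at hk
      rw [take_pre_of_le X (by omega)] at hh
      exact ⟨k, (h (n, pre X k)).2 ⟨_, hh⟩⟩
    · rintro ⟨k, hk⟩
      obtain ⟨s, hs⟩ := (h (n, pre X k)).1 hk
      have hex : ∃ m, M n (pre X m) (pre Z m) := by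
        refine ⟨max k s, k, by simp, ?_⟩
        rw [take_pre_of_le X (by simp)]
        exact hm _ _ _ (pre_prefix Z (by simp)) hs
      classical
      refine ⟨Nat.find hex, ?_, fun j hj => ?_⟩
      · simpa using Nat.find_spec hex
      · rw [length_pre] at hj
        rw [length_pre, take_pre_of_le X hj.le, take_pre_of_le Z hj.le]
        exact Nat.find_min hex hj

/-- A uniformly c.e. sequence of small open sets can be turned into a Martin-Löf test. -/
theorem exists_MLTest {A : Set ℕ} {W : ℕ → Set (List Bool)}
    (hW : Sig (chr A) fun x : ℕ × List Bool => x.2 ∈ W x.1)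
    (hmu : ∀ n, mu (Cyl (W n)) ≤ 2⁻¹ ^ n) :
    ∃ U, MLTest A U ∧ ∀ X, (∀ n, X ∈ Cyl (W n)) → X ∈ ⋂ n, U n := by
  have hC : ∀ n, Cyl {σ | ∃ m, σ ∈ W (n + 1 + m)} = ⋃ m, Cyl (W (n + 1 + m)) := by
    intro n
    ext X
    simp only [mem_Cyl, Set.mem_iUnion, Set.mem_ofPred_eq]
    exact exists_comm
  refine ⟨fun n => Cyl {σ | ∃ m, σ ∈ W (n + 1 + m)}, ⟨_, ?_, fun _ => rfl, fun n => ?_,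
    fun n => ?_⟩, fun X hX => ?_⟩
  all_goals beta_reduce
  · rw [ceSeqIn_iff]
    have := hW.comp (f := fun x : (ℕ × List Bool) × ℕ => (x.1.1 + 1 + x.2, x.1.2)) (by fun_prop)
    exact this.ex'
  · rw [hC, hC]
    refine Set.iUnion_subset fun m => ?_
    rw [show n + 1 + 1 + m = n + 1 + (m + 1) by omega]
    exact Set.subset_iUnion (fun m => Cyl (W (n + 1 + m))) (m + 1)
  · rw [hC]
    refine (measure_iUnion_le _).trans ((ENNReal.tsum_le_tsum fun m => hmu _).trans ?_)
    calc ∑' m, (2⁻¹ : ℝ≥0∞) ^ (n + 1 + m)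
        = ∑' m : ℕ, 2⁻¹ ^ n * 2⁻¹ ^ (Encodable.encode m + 1) := by
          refine tsum_congr fun m => ?_
          rw [← pow_add, Encodable.encode_nat]
          congr 1
          omega
      _ ≤ 2⁻¹ ^ n * 1 := by
          rw [ENNReal.tsum_mul_left]
          gcongr
          exact tsum_encode_le ℕ
      _ = _ := mul_one _
  · refine Set.mem_iInter.2 fun n => ?_
    rw [hC]
    exact Set.mem_iUnion.2 ⟨0, hX _⟩

theorem not_MLRandom {A : Set ℕ} {W : ℕ → Set (List Bool)}
    (hW : Sig (chr A) fun x : ℕ × List Bool => x.2 ∈ W x.1)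
    (hmu : ∀ n, mu (Cyl (W n)) ≤ 2⁻¹ ^ n) {X : ℕ → Bool} (hX : ∀ n, X ∈ Cyl (W n)) :
    ¬ MLRandom A X := by
  obtain ⟨U, hU, h⟩ := exists_MLTest hW hmu
  exact fun hr => hr U hU (h X hX)

theorem measurable_tail (n : ℕ) : Measurable fun X => tail X n :=
  measurable_pi_iff.2 fun _ => measurable_pi_apply _

theorem tail_app (σ : List Bool) (Y : ℕ → Bool) : tail (app σ Y) σ.length = Y :=
  funext fun i => app_add σ Y i

theorem mu_tail_inter {E : Set (ℕ → Bool)} (hE : MeasurableSet E) (σ : List Bool) :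
    mu ({X | tail X σ.length ∈ E} ∩ N σ) = 2⁻¹ ^ σ.length * mu E := by
  refine (mu_inter_N (measurable_tail σ.length hE) σ).trans ?_
  congr 2
  ext Y
  simp [tail_app]

theorem app_mem_Cyl_append {σ : List Bool} {W : Set (List Bool)} {Y : ℕ → Bool}
    (h : Y ∈ Cyl W) : app σ Y ∈ Cyl ((σ ++ ·) '' W) := by
  obtain ⟨n, hn⟩ := mem_Cyl.1 h
  exact mem_Cyl.2 ⟨σ.length + n, pre Y n, hn, (pre_app σ Y n).symm⟩

/-- The set of concatenations of `n` elements of `W`. -/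
def concatPow (W : Set (List Bool)) (n : ℕ) : Set (List Bool) :=
  {τ | ∃ l : List (List Bool), (l.length = n ∧ l.flatten = τ) ∧ ∀ σ ∈ l, σ ∈ W}

theorem concatPow_succ (W : Set (List Bool)) (n : ℕ) :
    concatPow W (n + 1) = ⋃ σ ∈ W, (σ ++ ·) '' concatPow W n := by
  ext τ
  simp only [concatPow, Set.mem_iUnion, Set.mem_image, Set.mem_ofPred_eq, exists_prop]
  constructor
  · rintro ⟨l, ⟨h1, h2⟩, h3⟩
    cases l with
    | nil => simp at h1
    | cons σ l =>
      rw [List.forall_mem_cons] at h3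
      exact ⟨σ, h3.1, _, ⟨l, ⟨by simpa using h1, rfl⟩, h3.2⟩, by simpa using h2⟩
  · rintro ⟨σ, hσ, _, ⟨l, ⟨rfl, rfl⟩, h⟩, rfl⟩
    exact ⟨σ :: l, ⟨by simp, by simp⟩, List.forall_mem_cons.2 ⟨hσ, h⟩⟩

theorem mu_concatPow_le (W : Set (List Bool)) (n : ℕ) :
    mu (Cyl (concatPow W n)) ≤ wt List.length W ^ n := by
  induction n with
  | zero => simpa using prob_le_one
  | succ n ih =>
    have : Cyl (concatPow W (n + 1)) ⊆
        ⋃ σ ∈ W, ({X | tail X σ.length ∈ Cyl (concatPow W n)} ∩ N σ) := by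
      rw [concatPow_succ]
      intro X hX
      obtain ⟨k, hk⟩ := mem_Cyl.1 hX
      simp only [Set.mem_iUnion, exists_prop] at hk ⊢
      obtain ⟨σ, hσ, τ, hτ, he⟩ := hk
      have hp : σ <+: pre X k := by
        rw [← he]
        exact List.prefix_append _ _
      have hN : X ∈ N σ := (eq_pre_of_prefix hp).symm
      refine ⟨σ, hσ, ?_, hN⟩
      obtain ⟨Y, rfl⟩ := mem_N_iff.1 hN
      rw [Set.mem_ofPred_eq, tail_app]
      refine mem_Cyl.2 ⟨τ.length, ?_⟩
      have hk : k = σ.length + τ.length := by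
        have := congrArg List.length he
        simpa using this.symm
      rw [hk, pre_app] at he
      rwa [← List.append_cancel_left he]
    refine (measure_mono this).trans ((measure_biUnion_le mu W.to_countable _).trans ?_)
    calc ∑' σ : W, mu ({X | tail X σ.1.length ∈ Cyl (concatPow W n)} ∩ N σ)
        = ∑' σ : W, 2⁻¹ ^ σ.1.length * mu (Cyl (concatPow W n)) :=
          tsum_congr fun σ => mu_tail_inter (measurableSet_Cyl _) _
      _ = wt List.length W * mu (Cyl (concatPow W n)) := ENNReal.tsum_mul_right
      _ ≤ wt List.length W * wt List.length W ^ n := by gcongr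
      _ = _ := (pow_succ' _ _).symm

theorem not_MLRandom_of_concatPow {A : Set ℕ} {W : Set (List Bool)}
    (hW : Sig (chr A) fun σ => σ ∈ W) (h1 : wt List.length W < 1) {X : ℕ → Bool}
    (hX : ∀ n, X ∈ Cyl (concatPow W n)) : ¬ MLRandom A X := by
  obtain ⟨k, hk⟩ : ∃ k, wt List.length W ^ k ≤ 2⁻¹ := by
    have := (ENNReal.tendsto_pow_atTop_nhds_zero_of_lt_one h1).eventually_le_const
      (u := 2⁻¹) (by simp)
    exact this.exists
  refine not_MLRandom (W := fun n => concatPow W (k * n)) ?_ (fun n => ?_) fun n => hX _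
  · have h1 : PrimrecPred fun x : (ℕ × List Bool) × List (List Bool) =>
      x.2.length = k * x.1.1 ∧ x.2.flatten = x.1.2 := by fun_prop
    have h2 := Sig.forall_mem (f := fun x : (ℕ × List Bool) × List (List Bool) => x.2)
      (p := fun _ σ => σ ∈ W) (by fun_prop) (hW.comp Primrec.snd)
    exact ((Sig.of_primrec h1).and h2).ex'
  · refine (mu_concatPow_le W _).trans ?_
    rw [pow_mul]
    gcongr

/-- Membership in a suitable test does not depend on a finite initial segment. -/
theorem exists_MLTest_tail {A : Set ℕ} {V : ℕ → Set (ℕ → Bool)} (hV : MLTest A V) :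
    ∃ U, MLTest A U ∧ ∀ ρ σ Y, app ρ Y ∈ ⋂ n, V n → app σ Y ∈ ⋂ n, U n := by
  obtain ⟨W, hW, hVW, -, hmu⟩ := hV
  rw [ceSeqIn_iff] at hW
  let m : ℕ → List Bool × List Bool → ℕ := fun n x => n + x.2.length + 1 + Encodable.encode x
  let T : ℕ → Set (List Bool) := fun n => {τ | ∃ x : (List Bool × List Bool) × (List Bool × ℕ),
    τ = x.1.1 ++ x.2.1 ∧ (x.1.2 ++ x.2.1).take x.2.2 ∈ W (m n x.1)}
  have hT : Sig (chr A) fun x : ℕ × List Bool => x.2 ∈ T x.1 := by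
    have h1 : PrimrecPred fun x : (ℕ × List Bool) × (List Bool × List Bool) × (List Bool × ℕ) =>
      x.1.2 = x.2.1.1 ++ x.2.2.1 := by fun_prop
    have h2 := hW.comp (f := fun x : (ℕ × List Bool) × (List Bool × List Bool) × (List Bool × ℕ) =>
      (x.1.1 + x.2.1.2.length + 1 + Encodable.encode x.2.1,
        (x.2.1.2 ++ x.2.2.1).take x.2.2.2)) (by fun_prop)
    exact ((Sig.of_primrec h1).and h2).ex'
  obtain ⟨U, hU, h⟩ : ∃ U, MLTest A U ∧ ∀ X, (∀ n, X ∈ Cyl (T n)) → X ∈ ⋂ n, U n := by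
    refine exists_MLTest hT fun n => ?_
    have : Cyl (T n) ⊆ ⋃ x : List Bool × List Bool,
        {X | tail X x.1.length ∈ app x.2 ⁻¹' V (m n x)} ∩ N x.1 := by
      intro X hX
      obtain ⟨k, ⟨⟨σ, ρ⟩, κ, j⟩, h1, h2⟩ := mem_Cyl.1 hX
      simp only at h1 h2
      have hp : σ <+: pre X k := by
        rw [h1]
        exact List.prefix_append _ _
      have hN : X ∈ N σ := (eq_pre_of_prefix hp).symm
      refine Set.mem_iUnion.2 ⟨(σ, ρ), ?_, hN⟩
      obtain ⟨Y, rfl⟩ := mem_N_iff.1 hN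
      rw [Set.mem_ofPred_eq, tail_app, Set.mem_preimage, hVW, mem_Cyl]
      have hk : k = σ.length + κ.length := by
        have := congrArg List.length h1
        simpa using this
      rw [hk, pre_app] at h1
      have hκ := List.append_cancel_left h1
      refine ⟨min j (ρ.length + κ.length), ?_⟩
      rw [← take_pre, pre_app, hκ]
      exact h2
    refine (measure_mono this).trans ((measure_iUnion_le _).trans ?_)
    calc ∑' x : List Bool × List Bool, mu ({X | tail X x.1.length ∈ app x.2 ⁻¹' V (m n x)} ∩ N x.1)
        ≤ ∑' x : List Bool × List Bool, 2⁻¹ ^ n * 2⁻¹ ^ (Encodable.encode x + 1) := by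
          refine ENNReal.tsum_le_tsum fun x => ?_
          have hVm : MeasurableSet (V (m n x)) := by
            rw [hVW]
            exact measurableSet_Cyl _
          rw [mu_tail_inter (measurable_app _ hVm)]
          refine (mul_le_of_le_one_left' (pow_le_one₀ (by simp) (by simp))).trans ?_
          have h1 : 2⁻¹ ^ x.2.length * mu (app x.2 ⁻¹' V (m n x)) ≤ 2⁻¹ ^ m n x := by
            rw [← mu_inter_N hVm]
            exact (measure_mono Set.inter_subset_left).trans (hmu _)
          have h2 : (2⁻¹ : ℝ≥0∞) ^ m n x =
              2⁻¹ ^ x.2.length * (2⁻¹ ^ n * 2⁻¹ ^ (Encodable.encode x + 1)) := by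
            rw [← pow_add, ← pow_add]
            congr 1
            simp only [m]
            omega
          rw [h2] at h1
          exact (ENNReal.mul_le_mul_iff_right (by simp) (by simp)).1 h1
      _ ≤ 2⁻¹ ^ n * 1 := by
          rw [ENNReal.tsum_mul_left]
          gcongr
          exact tsum_encode_le _
      _ = _ := mul_one _
  · refine ⟨U, hU, fun ρ σ Y hY => h _ fun n => ?_⟩
    have := Set.mem_iInter.1 hY (m n (σ, ρ))
    rw [hVW, mem_Cyl] at this
    obtain ⟨k, hk⟩ := this
    refine mem_Cyl.2 ⟨σ.length + k, ((σ, ρ), (pre Y k, k)), pre_app _ _ _, ?_⟩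
    change (ρ ++ pre Y k).take k ∈ W (m n (σ, ρ))
    rwa [← pre_app, take_pre_of_le _ (by omega)]

theorem MLRandom.app {A : Set ℕ} {ρ : List Bool} {Y : ℕ → Bool} (h : MLRandom A (app ρ Y))
    (σ : List Bool) : MLRandom A (app σ Y) := by
  intro V hV hm
  obtain ⟨U, hU, hh⟩ := exists_MLTest_tail hV
  exact h U hU (hh σ ρ Y hm)

end Tests

section Universal

open scoped ENNReal

@[fun_prop]
theorem primrec_filter {α β : Type*} [Primcodable α] [Primcodable β] {f : α → List β}
    {p : α → β → Prop} [∀ a, DecidablePred (p a)] (hf : Primrec f)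
    (hp : PrimrecPred fun x : α × β => p x.1 x.2) :
    Primrec fun a => (f a).filter fun b => p a b := by
  have h : Primrec fun a => (f a).flatMap fun b => if p a b then [b] else [] :=
    primrec_flatMap hf (primrec_ite (c := fun x : α × β => p x.1 x.2) hp (by fun_prop)
      (by fun_prop))
  refine h.of_eq fun a => ?_
  induction f a with
  | nil => rfl
  | cons b l ih =>
    rw [List.flatMap_cons, ih, List.filter_cons]
    by_cases hb : p a b <;> simp [hb]

theorem Sig.zero_stage {β : Type*} [Primcodable β] {p : β → Prop} (hp : Sig (chr ∅) p) :
    ∃ R : β → ℕ → Prop, (PrimrecPred fun x : β × ℕ => R x.1 x.2) ∧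
      (∀ a s t, s ≤ t → R a s → R a t) ∧ ∀ a, p a ↔ ∃ s, R a s := by
  obtain ⟨R, hR, hm, h⟩ := hp
  refine ⟨fun a s => R a (pre (chr ∅) s), ?_, fun a s t hst => hm _ _ _ (pre_prefix _ hst), h⟩
  rw [chr_empty]
  exact hR.comp (f := fun x : β × ℕ => (x.1, (List.range x.2).map fun _ => false)) (by fun_prop)

theorem Sig.of_stage {Z : ℕ → Bool} {β : Type*} [Primcodable β] {R : β → ℕ → Prop}
    (hR : PrimrecPred fun x : β × ℕ => R x.1 x.2) : Sig Z fun a => ∃ s, R a s :=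
  (Sig.of_primrec hR).ex'

theorem Sig.of_zero {Z : ℕ → Bool} {β : Type*} [Primcodable β] {p : β → Prop}
    (hp : Sig (chr ∅) p) : Sig Z p := by
  obtain ⟨R, hR, -, h⟩ := hp.zero_stage
  exact (Sig.of_stage hR).of_eq fun a => (h a).symm

theorem nodup_strs (n : ℕ) : (strs n).Nodup := by
  induction n with
  | zero => simp [strs]
  | succ n ih =>
    rw [strs, List.nodup_flatMap]
    refine ⟨fun σ _ => by simp, ih.imp fun {σ τ} hne => ?_⟩
    simp [Function.onFun]
    exact hne.symm

/-- A Martin-Löf random sequence lies in every c.e. open set of full measure. -/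
theorem not_MLRandom_of_notMem {W : Set (List Bool)} (hW : Sig (chr ∅) fun σ => σ ∈ W)
    (h1 : mu (Cyl W) = 1) {X : ℕ → Bool} (hX : X ∉ Cyl W) : ¬ MLRandom ∅ X := by
  classical
  obtain ⟨R, hR, hm, h⟩ := hW.zero_stage
  let P : List Bool → Prop := fun σ => ∃ k < σ.length + 1, R (σ.take k) σ.length
  have hP : PrimrecPred P := by
    have := hR.comp (f := fun x : List Bool × ℕ => (x.1.take x.2, x.1.length)) (by fun_prop)
    exact primrecPred_exists_lt (by fun_prop) this
  have hPm : ∀ X : ℕ → Bool, ∀ {s t}, s ≤ t → P (pre X s) → P (pre X t) := by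
    rintro X s t hst ⟨k, hk, hh⟩
    rw [length_pre] at hk hh
    rw [take_pre_of_le X (by omega)] at hh
    refine ⟨k, by simp; omega, ?_⟩
    rw [length_pre, take_pre_of_le X (by omega)]
    exact hm _ _ _ hst hh
  have hPW : ∀ X : ℕ → Bool, X ∈ Cyl W ↔ ∃ s, P (pre X s) := by
    intro X
    rw [mem_Cyl]
    constructor
    · rintro ⟨k, hk⟩
      obtain ⟨s, hs⟩ := (h _).1 hk
      refine ⟨max k s, k, by simp, ?_⟩
      rw [take_pre_of_le X (by simp), length_pre]
      exact hm _ _ _ (by simp) hs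
    · rintro ⟨s, k, hk, hh⟩
      rw [length_pre] at hk
      rw [take_pre_of_le X (by omega)] at hh
      exact ⟨k, (h _).2 ⟨_, hh⟩⟩
  let G : ℕ → Set (ℕ → Bool) := fun s => {X | ¬ P (pre X s)}
  let c : ℕ → ℕ := fun s => ((strs s).filter fun σ => ¬ P σ).length
  have hc : Primrec c := by
    have : PrimrecPred fun x : ℕ × List Bool => ¬ P x.2 := by fun_prop
    exact primrec_length (primrec_filter (p := fun _ σ => ¬ P σ) (by fun_prop) this)
  have hGC : ∀ s, G s = Cyl (((strs s).filter fun σ => ¬ P σ).toFinset : Set (List Bool)) := by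
    intro s
    ext X
    rw [mem_Cyl]
    simp only [List.coe_toFinset, List.mem_filter, mem_strs, Set.mem_ofPred_eq, length_pre, G,
      decide_eq_true_eq]
    exact ⟨fun h => ⟨s, rfl, h⟩, by rintro ⟨k, rfl, h⟩; exact h⟩
  have hG : ∀ s, mu (G s) = c s * 2⁻¹ ^ s := by
    intro s
    rw [hGC, mu_strings (n := s), List.toFinset_card_of_nodup ((nodup_strs s).filter _)]
    intro σ hσ
    simp only [List.mem_toFinset, List.mem_filter, mem_strs] at hσ
    exact hσ.1
  have hcond : ∀ n s, c s * 2 ^ n ≤ 2 ^ s ↔ mu (G s) ≤ 2⁻¹ ^ n := by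
    intro n s
    rw [hG, ← ENNReal.inv_pow, ← ENNReal.inv_pow, ← div_eq_mul_inv,
      ENNReal.div_le_iff (by simp) (by simp), mul_comm (_⁻¹), ← div_eq_mul_inv,
      ENNReal.le_div_iff_mul_le (by simp) (by simp)]
    exact_mod_cast Iff.rfl
  have hlim : Tendsto (fun s => mu (G s)) atTop (nhds 0) := by
    have h0 : mu (⋂ s, G s) = 0 := by
      have : ⋂ s, G s = (Cyl W)ᶜ := by
        ext X
        simp [hPW, G]
      rw [this, prob_compl_eq_zero_iff (measurableSet_Cyl W), h1]
    rw [← h0]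
    refine tendsto_measure_iInter_atTop (fun s => ?_) (fun s t hst X hX hP => hX (hPm X hst hP))
      ⟨0, by simp⟩
    rw [hGC]
    exact (measurableSet_Cyl _).nullMeasurableSet
  have hex : ∀ n, ∃ s, c s * 2 ^ n ≤ 2 ^ s := by
    intro n
    obtain ⟨s, hs⟩ := (hlim.eventually_le_const (u := 2⁻¹ ^ n)
      (ENNReal.pow_pos (by simp) _)).exists
    exact ⟨s, (hcond n s).2 hs⟩
  refine not_MLRandom (W := fun n => {σ | c σ.length * 2 ^ n ≤ 2 ^ σ.length ∧ ¬ P σ}) ?_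
    (fun n => ?_) fun n => ?_
  · refine Sig.of_primrec (p := fun x : ℕ × List Bool =>
      c x.2.length * 2 ^ x.1 ≤ 2 ^ x.2.length ∧ ¬ P x.2) ?_
    have : PrimrecPred fun x : ℕ × List Bool => ¬ P x.2 := by fun_prop
    exact PrimrecPred.and (by fun_prop) this
  · refine (measure_mono ?_).trans ((hcond n _).1 (Nat.find_spec (hex n)))
    intro X hX
    obtain ⟨m, hm1, hm2⟩ := mem_Cyl.1 hX
    rw [length_pre] at hm1
    exact fun hP => hm2 (hPm X (Nat.find_min' (hex n) hm1) hP)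
  · obtain ⟨s, hs⟩ := hex n
    refine mem_Cyl.2 ⟨s, by simpa using hs, fun hP => hX ((hPW X).2 ⟨s, hP⟩)⟩

theorem wt_le_of_forall_finset {β : Type*} {g : β → ℕ} {S : Set β} {c : ℝ≥0∞}
    (h : ∀ F : Finset β, (F : Set β) ⊆ S → ∑ x ∈ F, 2⁻¹ ^ g x ≤ c) : wt g S ≤ c := by
  rw [wt, ENNReal.tsum_eq_iSup_sum]
  refine iSup_le fun F => ?_
  have := h (F.map (Function.Embedding.subtype _)) (by simp)
  simpa using this

theorem wt_preimage {β γ : Type*} {f : β → γ} (hf : Function.Injective f) {g : γ → ℕ}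
    {S : Set γ} : wt (fun x => g (f x)) (f ⁻¹' S) ≤ wt g S :=
  ENNReal.tsum_comp_le_tsum_of_injective (f := fun x : f ⁻¹' S => (⟨f x, x.2⟩ : S))
    (fun _ _ h => Subtype.ext (hf (congrArg Subtype.val h))) fun y : S => (2⁻¹ : ℝ≥0∞) ^ g y

theorem wt_image {β γ : Type*} {f : β → γ} (hf : Function.Injective f) {g : γ → ℕ}
    {S : Set β} : wt g (f '' S) = wt (fun x => g (f x)) S :=
  tsum_image (fun y => (2⁻¹ : ℝ≥0∞) ^ g y) hf.injOn

section Trunc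

/-- The universal computable enumeration of uniformly c.e. sets of numbers, where the code of the
enumeration is the first component of the index. -/
def enumStage (e k s : ℕ) : Prop :=
  ∃ t < s, Nat.Partrec.Code.evaln s (Denumerable.ofNat Nat.Partrec.Code e.unpair.1)
    (Nat.pair (Nat.pair e k) t) = some 1

theorem primrecPred_enumStage :
    PrimrecPred fun x : (ℕ × ℕ) × ℕ => enumStage x.1.1 x.1.2 x.2 := by
  have h1 : Primrec fun x : ((ℕ × ℕ) × ℕ) × ℕ =>
      Denumerable.ofNat Nat.Partrec.Code x.1.1.1.unpair.1 :=
    (Primrec.ofNat _).comp (by fun_prop)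
  have h2 : Primrec fun x : ((ℕ × ℕ) × ℕ) × ℕ => Nat.Partrec.Code.evaln x.1.2
      (Denumerable.ofNat Nat.Partrec.Code x.1.1.1.unpair.1)
      (Nat.pair (Nat.pair x.1.1.1 x.1.1.2) x.2) :=
    Nat.Partrec.Code.primrec_evaln.comp (f := fun a : (ℕ × Nat.Partrec.Code) × ℕ =>
      Nat.Partrec.Code.evaln a.1.1 a.1.2 a.2)
      (g := fun x : ((ℕ × ℕ) × ℕ) × ℕ => ((x.1.2,
        Denumerable.ofNat Nat.Partrec.Code x.1.1.1.unpair.1),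
        Nat.pair (Nat.pair x.1.1.1 x.1.1.2) x.2)) (by fun_prop)
  exact primrecPred_exists_lt (by fun_prop) (primrecPred_eq h2 (by fun_prop))

theorem enumStage_mono {e k s t : ℕ} (h : s ≤ t) (hs : enumStage e k s) : enumStage e k t := by
  obtain ⟨i, hi, hh⟩ := hs
  exact ⟨i, hi.trans_le h, Nat.Partrec.Code.evaln_mono h hh⟩

theorem exists_enumStage {p : ℕ → ℕ → Prop} (hp : Sig (chr ∅) fun x : ℕ × ℕ => p x.1 x.2) :
    ∃ e₀, ∀ d k, p (Nat.pair e₀ d) k ↔ ∃ s, enumStage (Nat.pair e₀ d) k s := by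
  classical
  obtain ⟨R, hR, hm, h⟩ := hp.zero_stage
  have hF : Primrec fun n : ℕ => if R (n.unpair.1.unpair.1, n.unpair.1.unpair.2) n.unpair.2
      then 1 else 0 := by
    have := hR.comp (f := fun n : ℕ =>
      ((n.unpair.1.unpair.1, n.unpair.1.unpair.2), n.unpair.2)) (by fun_prop)
    exact Primrec.ite this (by fun_prop) (by fun_prop)
  obtain ⟨c, hc⟩ := Nat.Partrec.Code.exists_code.1 (Nat.Partrec.of_primrec (Primrec.nat_iff.1 hF))
  have hcR : ∀ e k t, 1 ∈ c.eval (Nat.pair (Nat.pair e k) t) ↔ R (e, k) t := by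
    intro e k t
    rw [hc]
    by_cases hh : R (e, k) t <;> simp [hh]
  refine ⟨Encodable.encode c, fun d k => ?_⟩
  rw [h (_, k)]
  simp only [enumStage, Nat.unpair_pair, Denumerable.ofNat_encode]
  constructor
  · rintro ⟨t, ht⟩
    obtain ⟨n, hn⟩ := Nat.Partrec.Code.evaln_complete.1 ((hcR _ _ _).2 ht)
    exact ⟨max n (t + 1), t, by simp, Nat.Partrec.Code.evaln_mono (le_max_left _ _) hn⟩
  · rintro ⟨s, t, -, ht⟩
    exact ⟨t, (hcR _ _ _).1 (Nat.Partrec.Code.evaln_sound ht)⟩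

open Classical in
/-- The finite set enumerated by stage `s`. -/
noncomputable def stageSet (g : ℕ → ℕ → ℕ) (e s : ℕ) : Finset ℕ :=
  (Finset.range s).filter fun k => enumStage e k s ∧ g e k ≤ s

theorem stageSet_mono (g : ℕ → ℕ → ℕ) (e : ℕ) {s t : ℕ} (h : s ≤ t) :
    stageSet g e s ⊆ stageSet g e t := by
  intro k
  simp only [stageSet, Finset.mem_filter, Finset.mem_range]
  exact fun ⟨h1, h2, h3⟩ => ⟨h1.trans_le h, enumStage_mono h h2, h3.trans h⟩

theorem exists_trunc_nat {g : ℕ → ℕ → ℕ} (hg : Primrec fun x : ℕ × ℕ => g x.1 x.2) :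
    ∃ T : ℕ → Set ℕ, (Sig (chr ∅) fun x : ℕ × ℕ => x.2 ∈ T x.1) ∧
      (∀ e, wt (g e) (T e) ≤ 1) ∧
      ∀ p : ℕ → Set ℕ, (Sig (chr ∅) fun x : ℕ × ℕ => x.2 ∈ p x.1) →
        ∃ e₀, ∀ d, wt (g (Nat.pair e₀ d)) (p (Nat.pair e₀ d)) ≤ 1 →
          T (Nat.pair e₀ d) = p (Nat.pair e₀ d) := by
  classical
  have hst : ∀ e s, ∑ k ∈ stageSet g e s, (2⁻¹ : ℝ≥0∞) ^ g e k ≤ 1 ↔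
      ∑ k ∈ Finset.range s, (if enumStage e k s ∧ g e k ≤ s then 2 ^ (s - g e k) else 0) ≤
        2 ^ s := by
    intro e s
    rw [← Finset.sum_filter]
    change _ ↔ ∑ k ∈ stageSet g e s, _ ≤ _
    have h1 : ∑ k ∈ stageSet g e s, (2⁻¹ : ℝ≥0∞) ^ g e k =
        ((∑ k ∈ stageSet g e s, 2 ^ (s - g e k) : ℕ) : ℝ≥0∞) / 2 ^ s := by
      push_cast
      rw [div_eq_mul_inv, Finset.sum_mul]
      refine Finset.sum_congr rfl fun k hk => ?_
      have hk : g e k ≤ s := by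
        simp only [stageSet, Finset.mem_filter] at hk
        exact hk.2.2
      have : (2 : ℝ≥0∞) ^ s = 2 ^ (s - g e k) * 2 ^ g e k := by
        rw [← pow_add, Nat.sub_add_cancel hk]
      rw [this, ENNReal.mul_inv (by simp) (by simp), ← mul_assoc,
        ENNReal.mul_inv_cancel (by simp) (by simp), one_mul, ENNReal.inv_pow]
    rw [h1, ENNReal.div_le_iff (by simp) (by simp), one_mul]
    exact_mod_cast Iff.rfl
  refine ⟨fun e => {k | ∃ s, k ∈ stageSet g e s ∧
    ∑ k ∈ stageSet g e s, (2⁻¹ : ℝ≥0∞) ^ g e k ≤ 1}, ?_, fun e => ?_, fun p hp => ?_⟩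
  · simp only [Set.mem_ofPred_eq, hst]
    refine Sig.of_stage ?_
    have hE := primrecPred_enumStage
    have h1 : PrimrecPred fun x : (ℕ × ℕ) × ℕ => x.1.2 ∈ stageSet g x.1.1 x.2 := by
      simp only [stageSet, Finset.mem_filter, Finset.mem_range]
      have : PrimrecPred fun x : (ℕ × ℕ) × ℕ => g x.1.1 x.1.2 ≤ x.2 :=
        primrecPred_le (hg.comp Primrec.fst) (by fun_prop)
      exact PrimrecPred.and (by fun_prop) (hE.and this)
    refine h1.and ?_
    have hg' := hg.comp (g := fun x : ((ℕ × ℕ) × ℕ) × ℕ => (x.1.1.1, x.2)) (by fun_prop)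
    have h2 := (hE.comp (f := fun x : ((ℕ × ℕ) × ℕ) × ℕ => ((x.1.1.1, x.2), x.1.2))
      (by fun_prop)).and (primrecPred_le hg' (g := fun x => x.1.2) (by fun_prop))
    refine primrecPred_le (primrec_sum_range (by fun_prop) ?_) (by fun_prop)
    exact Primrec.ite h2 (primrec_pow (by fun_prop) (primrec_sub (by fun_prop) hg')) (by fun_prop)
  · refine wt_le_of_forall_finset fun F hF => ?_
    choose! s hs using hF
    rcases F.eq_empty_or_nonempty with rfl | hne
    · simp
    obtain ⟨k, hk, hmax⟩ := F.exists_max_image s hne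
    refine (Finset.sum_le_sum_of_subset fun j hj => ?_).trans (hs hk).2
    exact stageSet_mono g e (hmax j hj) (hs hj).1
  · obtain ⟨e₀, he⟩ := exists_enumStage hp
    refine ⟨e₀, fun d hd => Set.ext fun k => ?_⟩
    refine Iff.trans ?_ (he d k).symm
    constructor
    · rintro ⟨s, hs, -⟩
      simp only [stageSet, Finset.mem_filter] at hs
      exact ⟨s, hs.2.1⟩
    · rintro ⟨s, hs⟩
      refine ⟨max s (max (k + 1) (g (Nat.pair e₀ d) k)), ?_, ?_⟩
      · simp only [stageSet, Finset.mem_filter, Finset.mem_range]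
        exact ⟨by simp, enumStage_mono (by simp) hs, by simp⟩
      · rw [← wt_finset]
        refine (wt_mono fun j hj => ?_).trans hd
        simp only [stageSet, Finset.coe_filter, Set.mem_ofPred_eq] at hj
        exact (he d j).2 ⟨_, hj.2.1⟩

/-- A uniform enumeration of all c.e. sets of weight at most one. -/
theorem exists_trunc {β : Type*} [Primcodable β] {g : ℕ → β → ℕ}
    (hg : Primrec fun x : ℕ × β => g x.1 x.2) :
    ∃ T : ℕ → Set β, (Sig (chr ∅) fun x : ℕ × β => x.2 ∈ T x.1) ∧
      (∀ e, wt (g e) (T e) ≤ 1) ∧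
      ∀ p : ℕ → Set β, (Sig (chr ∅) fun x : ℕ × β => x.2 ∈ p x.1) →
        ∃ e₀, ∀ d, wt (g (Nat.pair e₀ d)) (p (Nat.pair e₀ d)) ≤ 1 →
          T (Nat.pair e₀ d) = p (Nat.pair e₀ d) := by
  have hinj := Encodable.encode_injective (α := β)
  let g' : ℕ → ℕ → ℕ := fun e k => ((Encodable.decode k : Option β).map (g e)).getD 0
  have hg' : Primrec fun x : ℕ × ℕ => g' x.1 x.2 := by
    refine primrec_getD (Primrec.option_map (g := fun (x : ℕ × ℕ) b => g x.1 b) (by fun_prop) ?_)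
      (by fun_prop)
    exact hg.comp (g := fun x : (ℕ × ℕ) × β => (x.1.1, x.2)) (by fun_prop)
  have hgg : ∀ e, (fun x => g' e (Encodable.encode x)) = g e := fun e => funext fun x => by
    simp [g']
  obtain ⟨T, hT, h1, h2⟩ := exists_trunc_nat hg'
  refine ⟨fun e => Encodable.encode ⁻¹' T e, ?_, fun e => ?_, fun p hp => ?_⟩
  · exact hT.comp (f := fun x : ℕ × β => (x.1, Encodable.encode x.2)) (by fun_prop)
  · rw [← hgg]
    exact (wt_preimage hinj).trans (h1 e)
  · have h3 := hp.comp (f := fun x : (ℕ × ℕ) × β => (x.1.1, x.2)) (by fun_prop)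
    have h4 : PrimrecPred fun x : (ℕ × ℕ) × β => Encodable.encode x.2 = x.1.2 := by fun_prop
    obtain ⟨e₀, he⟩ := h2 (fun e => Encodable.encode '' p e) (h3.and (Sig.of_primrec h4)).ex'
    refine ⟨e₀, fun d hd => ?_⟩
    refine (congrArg _ (he d ?_)).trans (hinj.preimage_image _)
    rwa [wt_image hinj, hgg]

end Trunc

/-- There is a c.e. open set of measure at most one half containing all non-random sequences. -/
theorem exists_universal : ∃ T : Set (List Bool), (Sig (chr ∅) fun σ => σ ∈ T) ∧
    mu (Cyl T) ≤ 2⁻¹ ∧ ∀ X, ¬ MLRandom ∅ X → X ∈ Cyl T := by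
  obtain ⟨T, hT, h1, h2⟩ := exists_trunc (β := List Bool) (g := fun e σ => σ.length - (e + 2))
    (by fun_prop)
  refine ⟨{σ | ∃ e, σ ∈ T e ∧ e + 2 ≤ σ.length}, ?_, ?_, fun X hX => ?_⟩
  · have h3 := hT.comp (f := fun x : List Bool × ℕ => (x.2, x.1)) (by fun_prop)
    have h4 : PrimrecPred fun x : List Bool × ℕ => x.2 + 2 ≤ x.1.length := by fun_prop
    exact (h3.and (Sig.of_primrec h4)).ex'
  · have hsub : Cyl {σ | ∃ e, σ ∈ T e ∧ e + 2 ≤ σ.length} ⊆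
        ⋃ e, Cyl {σ | σ ∈ T e ∧ e + 2 ≤ σ.length} := by
      intro X hX
      obtain ⟨k, e, he⟩ := mem_Cyl.1 hX
      exact Set.mem_iUnion.2 ⟨e, mem_Cyl.2 ⟨k, he⟩⟩
    refine (measure_mono hsub).trans ((measure_iUnion_le _).trans ?_)
    calc ∑' e, mu (Cyl {σ | σ ∈ T e ∧ e + 2 ≤ σ.length})
        ≤ ∑' e : ℕ, 2⁻¹ * 2⁻¹ ^ (Encodable.encode e + 1) := by
          refine ENNReal.tsum_le_tsum fun e => (mu_Cyl_le_wt _).trans ?_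
          calc wt List.length {σ | σ ∈ T e ∧ e + 2 ≤ σ.length}
              = ∑' σ : {σ | σ ∈ T e ∧ e + 2 ≤ σ.length},
                  2⁻¹ ^ (e + 2) * 2⁻¹ ^ (σ.1.length - (e + 2)) := by
                refine tsum_congr fun σ => ?_
                rw [← pow_add, Nat.add_sub_cancel' σ.2.2]
            _ = 2⁻¹ ^ (e + 2) * wt (fun σ => σ.length - (e + 2))
                  {σ | σ ∈ T e ∧ e + 2 ≤ σ.length} := ENNReal.tsum_mul_left
            _ ≤ 2⁻¹ ^ (e + 2) * 1 := by
                gcongr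
                exact (wt_mono fun σ h => h.1).trans (h1 e)
            _ = _ := by
                rw [mul_one, pow_succ', Encodable.encode_nat]
      _ ≤ 2⁻¹ * 1 := by
          rw [ENNReal.tsum_mul_left]
          gcongr
          exact tsum_encode_le ℕ
      _ = _ := mul_one _
  · rw [MLRandom] at hX
    push Not at hX
    obtain ⟨U, ⟨W, hW, hUW, -, hmu⟩, hX⟩ := hX
    rw [ceSeqIn_iff] at hW
    obtain ⟨Q, hQ, hQW⟩ := exists_prefixFree hW
    have hsig := Sig.of_pre (Z := chr ∅) (f := fun x : ℕ × List Bool => x.2.length)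
      (Q := fun x α => Q (x.1 + 2) x.2 α) (hQ.comp (f := fun x : (ℕ × List Bool) × List Bool =>
        ((x.1.1 + 2, x.1.2), x.2)) (by fun_prop)) (by fun_prop)
    obtain ⟨e₀, he⟩ := h2 (fun e => {σ | Q (e + 2) σ (pre (chr ∅) σ.length)}) hsig
    set e := Nat.pair e₀ 0
    have hwt : wt List.length {σ | Q (e + 2) σ (pre (chr ∅) σ.length)} ≤ 2⁻¹ ^ (e + 2) := by
      rw [← mu_Cyl_eq_wt (hQW _).1, (hQW _).2, ← hUW]
      exact hmu _
    have hlen : ∀ σ ∈ {σ | Q (e + 2) σ (pre (chr ∅) σ.length)}, e + 2 ≤ σ.length := by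
      intro σ hσ
      have h3 : wt List.length ((({σ} : Finset (List Bool))) : Set (List Bool)) ≤
        2⁻¹ ^ (e + 2) := (wt_mono (by simpa using hσ)).trans hwt
      rw [wt_finset, Finset.sum_singleton] at h3
      by_contra! hlt
      exact absurd h3 (not_le.2 (by
        rw [← ENNReal.inv_pow, ← ENNReal.inv_pow, ENNReal.inv_lt_inv]
        exact_mod_cast Nat.pow_lt_pow_right (by norm_num : 1 < 2) hlt))
    have hT : T e = {σ | Q (e + 2) σ (pre (chr ∅) σ.length)} := by
      refine he 0 ?_
      have h3 : wt List.length {σ | Q (e + 2) σ (pre (chr ∅) σ.length)} = 2⁻¹ ^ (e + 2) *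
          wt (fun σ => σ.length - (e + 2)) {σ | Q (e + 2) σ (pre (chr ∅) σ.length)} := by
        rw [wt, wt, ← ENNReal.tsum_mul_left]
        refine tsum_congr fun σ => ?_
        rw [← pow_add, Nat.add_sub_cancel' (hlen σ σ.2)]
      rw [h3] at hwt
      exact (ENNReal.mul_le_mul_iff_right (by simp) (by simp)).1 (hwt.trans_eq (mul_one _).symm)
    have hXe := Set.mem_iInter.1 hX (e + 2)
    rw [hUW, ← (hQW _).2, ← hT] at hXe
    obtain ⟨k, hk⟩ := mem_Cyl.1 hXe
    exact mem_Cyl.2 ⟨k, e, hk, hlen _ (hT ▸ hk)⟩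

end Universal

section Cover

open scoped ENNReal

theorem exists_limit {τ : ℕ → List Bool} (h : ∀ n, τ n <+: τ (n + 1))
    (hl : ∀ n, n ≤ (τ n).length) : ∃ X : ℕ → Bool, ∀ n, X ∈ N (τ n) := by
  have hm : ∀ {m n}, m ≤ n → τ m <+: τ n := by
    intro m n hmn
    induction n, hmn using Nat.le_induction with
    | base => exact List.prefix_rfl
    | succ n _ ih => exact ih.trans (h n)
  refine ⟨fun i => (τ (i + 1))[i]'(hl (i + 1)), fun n => mem_N.2 (pre_eq_iff.2 ⟨rfl, ?_⟩)⟩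
  intro i hi
  rcases le_total (i + 1) n with h' | h'
  · exact (hm h').getElem _
  · exact ((hm h').getElem hi).symm

theorem N_append_subset_Cyl {T : Set (List Bool)} {X : ℕ → Bool} {σ : List Bool} {k : ℕ}
    (hk : pre X k ∈ T) (hX : X ∈ N σ) (hkσ : k ≤ σ.length) : N σ ⊆ Cyl T := by
  intro Y hY
  refine mem_Cyl.2 ⟨k, ?_⟩
  have h1 := take_pre_of_le Y hkσ
  rw [mem_N.1 hY] at h1
  have h2 := take_pre_of_le X hkσ
  rw [mem_N.1 hX, h1] at h2
  rwa [h2]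

theorem exists_string_forall_subset {A : Set ℕ} (H : ∀ X, MLRandom ∅ X → MLRandom A X)
    {T : Set (List Bool)} (hT : ∀ X, ¬ MLRandom ∅ X → X ∈ Cyl T) (hT1 : mu (Cyl T) ≤ 2⁻¹)
    {W : Set (List Bool)} (hW : Sig (chr A) fun σ => σ ∈ W) (h1 : wt List.length W < 1) :
    ∃ τ, ¬ N τ ⊆ Cyl T ∧ ∀ σ ∈ W, N (τ ++ σ) ⊆ Cyl T := by
  by_contra! hc
  choose f hfW hf using hc
  have h0 : ¬ N [] ⊆ Cyl T := by
    intro h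
    have := (measure_mono h).trans hT1
    rw [mu_N] at this
    simp at this
  let t : ℕ → {τ : List Bool // ¬ N τ ⊆ Cyl T} := fun n =>
    Nat.rec ⟨[], h0⟩ (fun _ τ => ⟨τ.1 ++ f τ.1 τ.2, hf τ.1 τ.2⟩) n
  have ht : ∀ n, (t (n + 1)).1 = (t n).1 ++ f (t n).1 (t n).2 := fun n => rfl
  have hnil : [] ∉ W := by
    intro h
    have h2 : wt List.length ((({[]} : Finset (List Bool))) : Set (List Bool)) ≤ _ :=
      wt_mono (g := List.length) (T := W) (by simpa using h)
    rw [wt_finset] at h2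
    simp only [Finset.sum_singleton, List.length_nil, pow_zero] at h2
    exact absurd h1 (not_lt.2 h2)
  obtain ⟨X, hX⟩ := exists_limit (τ := fun n => (t n).1) (fun n => ⟨_, (ht n).symm⟩) (by
    intro n
    induction n with
    | zero => simp
    | succ n ih =>
      have : 0 < (f (t n).1 (t n).2).length := List.length_pos_of_ne_nil fun h =>
        hnil (h ▸ hfW (t n).1 (t n).2)
      simp only [ht, List.length_append]
      omega)
  have hlen : ∀ n, n ≤ (t n).1.length := by
    intro n
    induction n with
    | zero => simp
    | succ n ih =>
      have : 0 < (f (t n).1 (t n).2).length := List.length_pos_of_ne_nil fun h =>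
        hnil (h ▸ hfW (t n).1 (t n).2)
      simp only [ht, List.length_append]
      omega
  have hr : MLRandom ∅ X := by
    by_contra hr
    obtain ⟨k, hk⟩ := mem_Cyl.1 (hT X hr)
    exact (t k).2 (N_append_subset_Cyl hk (hX k) (hlen k))
  refine not_MLRandom_of_concatPow hW h1 (fun n => ?_) (H X hr)
  have hmem : ∀ n, (t n).1 ∈ concatPow W n := by
    intro n
    induction n with
    | zero => exact ⟨[], ⟨rfl, rfl⟩, by simp⟩
    | succ n ih =>
      obtain ⟨l, ⟨hl1, hl2⟩, hl3⟩ := ih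
      refine ⟨l ++ [f (t n).1 (t n).2], ⟨by simp [hl1], by simp [hl2, ht]⟩, ?_⟩
      intro σ hσ
      rcases List.mem_append.1 hσ with h | h
      · exact hl3 σ h
      · rw [List.mem_singleton.1 h]
        exact hfW _ _
  exact mem_Cyl.2 ⟨(t n).1.length, by rw [mem_N.1 (hX n)]; exact hmem n⟩

theorem isClosed_N (σ : List Bool) : IsClosed (N σ) := by
  have : N σ = (Cyl {τ | τ.length = σ.length ∧ τ ≠ σ})ᶜ := by
    ext X
    rw [Set.mem_compl_iff, mem_Cyl, mem_N]
    constructor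
    · rintro h ⟨n, hn1, hn2⟩
      rw [length_pre] at hn1
      rw [hn1] at hn2
      exact hn2 h
    · intro h
      by_contra h'
      exact h ⟨σ.length, by simp, h'⟩
  rw [this]
  exact (isOpen_Cyl _).isClosed_compl

theorem N_subset_Cyl_iff {σ : List Bool} {R : List Bool → ℕ → Prop}
    (hm : ∀ a s t, s ≤ t → R a s → R a t) :
    N σ ⊆ Cyl {τ | ∃ s, R τ s} ↔
      ∃ n, ∀ ρ ∈ strs n, ∃ k < σ.length + n + 1, R ((σ ++ ρ).take k) n := by
  constructor
  · intro h
    obtain ⟨n, hn⟩ := (isClosed_N σ).isCompact.elim_directed_cover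
      (fun n => Cyl {τ | τ.length ≤ n ∧ R τ n}) (fun n => isOpen_Cyl _) (by
        intro X hX
        obtain ⟨k, s, hs⟩ := mem_Cyl.1 (h hX)
        refine Set.mem_iUnion.2 ⟨max k s, mem_Cyl.2 ⟨k, by simp, hm _ _ _ (by simp) hs⟩⟩) (by
        refine directed_of_isDirected_le fun s t hst X hX => ?_
        obtain ⟨k, hk1, hk2⟩ := mem_Cyl.1 hX
        exact mem_Cyl.2 ⟨k, hk1.trans hst, hm _ _ _ hst hk2⟩)
    refine ⟨n, fun ρ hρ => ?_⟩
    rw [mem_strs] at hρ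
    have hX := app_mem_N (σ ++ ρ) fun _ => false
    obtain ⟨k, hk1, hk2⟩ := mem_Cyl.1 (hn (N_subset_N (List.prefix_append σ ρ) hX))
    rw [length_pre] at hk1
    have hk : k ≤ (σ ++ ρ).length := by rw [List.length_append]; omega
    refine ⟨k, by omega, ?_⟩
    rwa [← take_pre_of_le _ hk, mem_N.1 hX] at hk2
  · rintro ⟨n, hn⟩ X hX
    obtain ⟨Y, rfl⟩ := mem_N_iff.1 hX
    obtain ⟨k, hk, hR⟩ := hn (pre Y n) (by simp [mem_strs])
    rw [← pre_app, take_pre_of_le _ (by omega)] at hR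
    exact mem_Cyl.2 ⟨k, _, hR⟩

theorem Sig.N_subset_Cyl {γ : Type*} [Primcodable γ] {W : γ → Set (List Bool)}
    (hW : Sig (chr ∅) fun x : γ × List Bool => x.2 ∈ W x.1) {Z : ℕ → Bool} :
    Sig Z fun x : γ × List Bool => N x.2 ⊆ Cyl (W x.1) := by
  obtain ⟨R, hR, hm, h⟩ := hW.zero_stage
  have h1 := hR.comp (f := fun x : (((γ × List Bool) × ℕ) × List Bool) × ℕ =>
    ((x.1.1.1.1, (x.1.1.1.2 ++ x.1.2).take x.2), x.1.1.2)) (by fun_prop)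
  have h2 := primrecPred_exists_lt (f := fun x : ((γ × List Bool) × ℕ) × List Bool =>
    x.1.1.2.length + x.1.2 + 1) (p := fun x k => R (x.1.1.1, (x.1.1.2 ++ x.2).take k) x.1.2)
    (by fun_prop) h1
  have h3 := primrecPred_forall_mem (f := fun x : (γ × List Bool) × ℕ => strs x.2)
    (p := fun x ρ => ∃ k < x.1.2.length + x.2 + 1, R (x.1.1, (x.1.2 ++ ρ).take k) x.2)
    (by fun_prop) h2
  refine (Sig.of_primrec h3).ex'.of_eq fun x => ?_
  refine (N_subset_Cyl_iff (σ := x.2) (R := fun τ s => R (x.1, τ) s)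
    (fun a s t => hm (x.1, a) s t)).symm.trans ?_
  have : W x.1 = {τ | ∃ s, R (x.1, τ) s} := Set.ext fun τ => h (x.1, τ)
  rw [this]

/-- The sequences vanishing at the given positions. -/
def vanish (F : Finset ℕ) : Set (ℕ → Bool) := {X | ∀ p ∈ F, X p = false}

theorem measurableSet_vanish (F : Finset ℕ) : MeasurableSet (vanish F) := by
  have : vanish F = ⋂ p ∈ F, (fun X => X p) ⁻¹' {false} := by
    ext X
    simp [vanish]
  rw [this]
  exact Finset.measurableSet_biInter _ fun p _ => measurable_pi_apply p (measurableSet_singleton _)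

theorem mu_eq_infinitePi :
    mu = Measure.infinitePi fun _ : ℕ => (PMF.uniformOfFintype Bool).toMeasure := by
  have hc : ∀ b : Bool, (PMF.uniformOfFintype Bool).toMeasure {b} = 2⁻¹ := by
    intro b
    rw [PMF.toMeasure_apply_singleton _ _ (measurableSet_singleton b)]
    simp
  refine ext_of_N fun σ => ?_
  have : N σ = Set.pi (Finset.range σ.length) fun i => {(σ[i]?).getD false} := by
    ext X
    rw [mem_N, pre_eq_iff]
    simp only [true_and, Set.mem_pi, Finset.coe_range, Set.mem_Iio, Set.mem_singleton_iff]
    refine forall₂_congr fun i hi => ?_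
    simp [hi]
  rw [mu_N, this, Measure.infinitePi_pi _ (fun _ _ => measurableSet_singleton _)]
  simp [hc]

theorem mu_vanish (F : Finset ℕ) : mu (vanish F) = 2⁻¹ ^ F.card := by
  have hc : (PMF.uniformOfFintype Bool).toMeasure {false} = 2⁻¹ := by
    rw [PMF.toMeasure_apply_singleton _ _ (measurableSet_singleton false)]
    simp
  have : vanish F = Set.pi (F : Set ℕ) fun _ => {false} := by
    ext X
    simp [vanish]
  rw [mu_eq_infinitePi, this, Measure.infinitePi_pi _ (fun _ _ => measurableSet_singleton _)]
  simp [hc]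

theorem mu_eq_one_of_vanish {β : Type*} [Encodable β] {g : β → ℕ} {J : Set β}
    (hJ : wt g J = ⊤) {F : β → Finset ℕ} (hF : ∀ x, (F x).card = g x)
    (hd : ∀ x y, x ≠ y → Disjoint (F x) (F y)) {E : Set (ℕ → Bool)}
    (hE : ∀ x ∈ J, vanish (F x) ⊆ E) : mu E = 1 := by
  classical
  let s : ℕ → Set (ℕ → Bool) := fun n => {X | ∃ x ∈ J, Encodable.encode x = n ∧ X ∈ vanish (F x)}
  have hs1 : ∀ x ∈ J, s (Encodable.encode x) = vanish (F x) := by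
    intro x hx
    ext X
    constructor
    · rintro ⟨y, -, hy, h⟩
      rwa [← Encodable.encode_injective hy]
    · exact fun h => ⟨x, hx, rfl, h⟩
  have hs2 : ∀ n, (¬ ∃ x ∈ J, Encodable.encode x = n) → s n = ∅ := by
    rintro n h
    refine Set.eq_empty_iff_forall_notMem.2 ?_
    rintro X ⟨x, hx, hn, -⟩
    exact h ⟨x, hx, hn⟩
  have hsm : ∀ n, MeasurableSet (s n) := by
    intro n
    by_cases h : ∃ x ∈ J, Encodable.encode x = n
    · obtain ⟨x, hx, rfl⟩ := h
      rw [hs1 x hx]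
      exact measurableSet_vanish _
    · rw [hs2 n h]
      exact MeasurableSet.empty
  have hind : ProbabilityTheory.iIndepSet s mu := by
    rw [ProbabilityTheory.iIndepSet_iff_meas_biInter hsm]
    intro t
    by_cases h : ∀ n ∈ t, ∃ x ∈ J, Encodable.encode x = n
    · obtain ⟨x, hx, hxn⟩ : ∃ x : ℕ → β, (∀ n ∈ t, x n ∈ J) ∧
          ∀ n ∈ t, Encodable.encode (x n) = n := by
        rcases t.eq_empty_or_nonempty with rfl | ⟨n, hn⟩
        · by_cases hβ : Nonempty β
          · exact ⟨fun _ => hβ.some, by simp, by simp⟩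
          · have := not_nonempty_iff.1 hβ
            exact absurd hJ (by simp [wt])
        · have : Nonempty β := ⟨(h n hn).choose⟩
          choose! x hx using h
          exact ⟨x, fun n hn => (hx n hn).1, fun n hn => (hx n hn).2⟩
      have h1 : ⋂ n ∈ t, s n = vanish (t.biUnion fun n => F (x n)) := by
        ext X
        simp only [Set.mem_iInter, vanish, Finset.mem_biUnion]
        constructor
        · rintro h p ⟨n, hn, hp⟩
          have := h n hn
          rw [← hxn n hn, hs1 _ (hx n hn)] at this
          exact this p hp
        · intro h n hn
          rw [← hxn n hn, hs1 _ (hx n hn)]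
          exact fun p hp => h p ⟨n, hn, hp⟩
      rw [h1, mu_vanish, Finset.card_biUnion, ← Finset.prod_pow_eq_pow_sum]
      · refine Finset.prod_congr rfl fun n hn => ?_
        rw [← mu_vanish, ← hs1 _ (hx n hn), hxn n hn]
      · intro m hm n hn hmn
        refine hd _ _ fun h => hmn ?_
        rw [← hxn m hm, ← hxn n hn, h]
    · push Not at h
      obtain ⟨n, hn, h⟩ := h
      have h0 := hs2 n (by push Not; exact h)
      rw [Finset.prod_eq_zero hn (by rw [h0, measure_empty])]
      exact measure_mono_null (Set.biInter_subset_of_mem hn) (by rw [h0, measure_empty])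
  have hsum : ∑' n, mu (s n) = ⊤ := by
    rw [← top_le_iff, ← hJ]
    calc wt g J = ∑' x : J, mu (s (Encodable.encode x.1)) :=
          tsum_congr fun x => by rw [hs1 _ x.2, mu_vanish, hF]
      _ ≤ _ := ENNReal.tsum_comp_le_tsum_of_injective (f := fun x : J => Encodable.encode x.1)
          (Encodable.encode_injective.comp Subtype.val_injective) fun n => mu (s n)
  have := ProbabilityTheory.measure_limsup_eq_one hsm hind hsum
  refine le_antisymm prob_le_one (this ▸ measure_mono fun X hX => ?_)
  rw [Filter.limsup_eq_iInf_iSup_of_nat] at hX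
  simp only [Set.iInf_eq_iInter, Set.iSup_eq_iUnion, Set.mem_iInter, Set.mem_iUnion] at hX
  obtain ⟨n, -, x, hx, -, hX⟩ := hX 0
  exact hE x hx hX

/-- Bounded-weight sets c.e. in `A` are covered by bounded-weight c.e. sets when `A` is low for
randomness. -/
theorem exists_cover {A : Set ℕ} (H : ∀ X, MLRandom ∅ X → MLRandom A X) {β : Type*}
    [Primcodable β] {g : β → ℕ} (hg : Primrec g) {I : Set β}
    (hI : Sig (chr A) fun x => x ∈ I) (h1 : wt g I < 1) :
    ∃ J : Set β, (Sig (chr ∅) fun x => x ∈ J) ∧ I ⊆ J ∧ wt g J ≠ ⊤ := by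
  classical
  obtain ⟨T, hT, hT1, hTR⟩ := exists_universal
  let F : β → Finset ℕ := fun x =>
    (Finset.range (g x)).map ⟨Nat.pair (Encodable.encode x), fun i j h => by
      simpa using h⟩
  have hF : ∀ x, (F x).card = g x := by simp [F]
  have hd : ∀ x y, x ≠ y → Disjoint (F x) (F y) := by
    intro x y hxy
    rw [Finset.disjoint_left]
    intro p hx hy
    simp only [F, Finset.mem_map, Finset.mem_range] at hx hy
    obtain ⟨i, -, rfl⟩ := hx
    obtain ⟨j, -, hj⟩ := hy
    exact hxy (Encodable.encode_injective (Nat.pair_eq_pair.1 hj).1).symm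
  let m : β → ℕ := fun x => Nat.pair (Encodable.encode x) (g x)
  let Q : β → List Bool → Prop := fun x σ =>
    ∀ i < g x, σ[Nat.pair (Encodable.encode x) i]? = some false
  have hQ : PrimrecPred fun x : β × List Bool => Q x.1 x.2 :=
    primrecPred_forall_lt (by fun_prop) (primrecPred_eq (by fun_prop) (by fun_prop))
  have hQF : ∀ x X, Q x (pre X (m x)) ↔ X ∈ vanish (F x) := by
    intro x X
    simp only [Q, F, vanish, Finset.mem_map, Finset.mem_range]
    have hlt : ∀ i < g x, Nat.pair (Encodable.encode x) i < m x := fun i hi =>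
      Nat.pair_lt_pair_right _ hi
    constructor
    · rintro h p ⟨i, hi, rfl⟩
      have := h i hi
      rwa [getElem?_pre _ (hlt i hi), Option.some_inj] at this
    · intro h i hi
      rw [getElem?_pre _ (hlt i hi)]
      exact congrArg some (h _ ⟨i, hi, rfl⟩)
  let Wx : β → Set (List Bool) := fun x => {σ | σ.length = m x ∧ Q x σ}
  have hWx : ∀ x, wt List.length (Wx x) = 2⁻¹ ^ g x := by
    intro x
    have hpf : PF (Wx x) := fun σ hσ τ hτ h => h.eq_of_length (hσ.1.trans hτ.1.symm)
    rw [← mu_Cyl_eq_wt hpf, ← hF, ← mu_vanish]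
    congr 1
    ext X
    rw [mem_Cyl, ← hQF]
    constructor
    · rintro ⟨n, hn, h⟩
      rw [length_pre] at hn
      exact hn ▸ h
    · exact fun h => ⟨m x, by simp, h⟩
  let W : Set (List Bool) := ⋃ x ∈ I, Wx x
  have hWwt : wt List.length W < 1 :=
    calc wt List.length W ≤ ∑' x : I, wt List.length (Wx x) := by
          exact ENNReal.tsum_biUnion_le_tsum (fun σ : List Bool => 2⁻¹ ^ σ.length) I Wx
      _ = wt g I := tsum_congr fun x => hWx x
      _ < 1 := h1
  have hW : Sig (chr A) fun σ => σ ∈ W := by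
    have h2 : PrimrecPred fun x : List Bool × β => x.1.length = m x.2 ∧ Q x.2 x.1 :=
      (primrecPred_eq (by fun_prop) (by fun_prop)).and
        (hQ.comp (f := fun x : List Bool × β => (x.2, x.1)) (by fun_prop))
    have h3 := hI.comp (f := fun x : List Bool × β => x.2) (by fun_prop)
    refine (h3.and (Sig.of_primrec h2)).ex'.of_eq fun σ => ?_
    simp only [W, Wx, Set.mem_iUnion, Set.mem_ofPred_eq, exists_prop]
  obtain ⟨τ, hτ, hτW⟩ := exists_string_forall_subset H hTR hT1 hW hWwt
  have hTN : Sig (chr ∅) fun σ => N σ ⊆ Cyl T :=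
    (Sig.N_subset_Cyl (W := fun _ : Unit => T) (hT.comp (by fun_prop))).comp
      (f := fun σ => ((), σ)) (by fun_prop)
  refine ⟨{x | ∀ σ ∈ strs (m x), Q x σ → N (τ ++ σ) ⊆ Cyl T}, ?_, ?_, ?_⟩
  · have h2 := hTN.comp (f := fun x : β × List Bool => τ ++ x.2) (by fun_prop)
    exact Sig.forall_mem (f := fun x => strs (m x)) (by fun_prop) (Sig.imp hQ h2)
  · intro x hx σ hσ hQσ
    exact hτW σ (Set.mem_biUnion hx ⟨mem_strs.1 hσ, hQσ⟩)
  · intro htop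
    have h3 : mu (app τ ⁻¹' Cyl T) = 1 := by
      refine mu_eq_one_of_vanish htop hF hd fun x hx X hX => ?_
      have h4 := hx (pre X (m x)) (by simp [mem_strs]) ((hQF x X).2 hX)
      apply h4
      rw [mem_N, List.length_append, length_pre, pre_app]
    have h4 : app τ ⁻¹' Cyl T = Cyl {σ | N (τ ++ σ) ⊆ Cyl T} := by
      ext Y
      have hY : ∀ k, app τ Y ∈ N (τ ++ pre Y k) := fun k => by
        rw [mem_N, List.length_append, length_pre, pre_app]
      rw [Set.mem_preimage, mem_Cyl (W := {σ | N (τ ++ σ) ⊆ Cyl T})]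
      constructor
      · intro h
        obtain ⟨k, hk⟩ := mem_Cyl.1 h
        exact ⟨k, N_append_subset_Cyl hk (hY k) (by simp)⟩
      · rintro ⟨k, hk⟩
        exact hk (hY k)
    have h5 : Sig (chr ∅) fun σ => σ ∈ {σ | N (τ ++ σ) ⊆ Cyl T} :=
      hTN.comp (f := fun σ => τ ++ σ) (by fun_prop)
    obtain ⟨X, hX, hXT⟩ := Set.not_subset.1 hτ
    obtain ⟨Y, rfl⟩ := mem_N_iff.1 hX
    have hR : MLRandom ∅ (app τ Y) := by
      by_contra hR
      exact hXT (hTR _ hR)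
    have hR' := hR.app []
    rw [app_nil] at hR'
    rw [h4] at h3
    refine not_MLRandom_of_notMem h5 h3 (fun hY => ?_) hR'
    rw [← h4] at hY
    exact hXT hY

end Cover

section Approx

open scoped ENNReal

theorem wt_add {β : Type*} (g : β → ℕ) (d : ℕ) (S : Set β) :
    wt (fun x => g x + d) S = 2⁻¹ ^ d * wt g S := by
  rw [wt, wt, ← ENNReal.tsum_mul_left]
  exact tsum_congr fun x => by rw [pow_add, mul_comm]

theorem wt_union_le {β : Type*} (g : β → ℕ) (S T : Set β) :
    wt g (S ∪ T) ≤ wt g S + wt g T :=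
  ENNReal.tsum_union_le (fun x => (2⁻¹ : ℝ≥0∞) ^ g x) S T

theorem wt_iUnion_le {β ι : Type*} (g : β → ℕ) (S : ι → Set β) :
    wt g (⋃ i, S i) ≤ ∑' i, wt g (S i) :=
  ENNReal.tsum_iUnion_le_tsum (fun x => (2⁻¹ : ℝ≥0∞) ^ g x) S

theorem mul_wt_le {β γ : Type*} {g : γ → ℕ} {h : β → ℕ} {S : Set β} {T : Set γ} {c : ℕ}
    (F : β → Finset γ) (p : γ → β) (hc : ∀ x ∈ S, (F x).card = c)
    (hF : ∀ x ∈ S, ∀ y ∈ F x, y ∈ T ∧ g y = h x ∧ p y = x) : c * wt h S ≤ wt g T := by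
  have h1 : (c : ℝ≥0∞) * wt h S = ∑' z : (x : S) × F x.1, 2⁻¹ ^ g z.2.1 := by
    rw [ENNReal.tsum_sigma', wt, ← ENNReal.tsum_mul_left]
    refine tsum_congr fun x => ?_
    rw [tsum_fintype, Finset.sum_congr rfl fun y _ => by rw [(hF x x.2 y.1 y.2).2.1]]
    simp [hc x x.2]
  rw [h1]
  refine ENNReal.tsum_comp_le_tsum_of_injective
    (f := fun z : (x : S) × F x.1 => (⟨z.2.1, (hF z.1.1 z.1.2 z.2.1 z.2.2).1⟩ : T)) ?_
    fun y : T => (2⁻¹ : ℝ≥0∞) ^ g y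
  rintro ⟨⟨x, hx⟩, ⟨y, hy⟩⟩ ⟨⟨x', hx'⟩, ⟨y', hy'⟩⟩ heq
  have hyy : y = y' := congrArg Subtype.val heq
  subst hyy
  have hxx : x = x' := (hF x hx y hy).2.2.symm.trans (hF x' hx' y hy').2.2
  subst hxx
  rfl

/-- At least `c` strings of length `n` are paired with `j` in `T`. -/
def Many (T : Set (List Bool × ℕ)) (c n j : ℕ) : Prop :=
  ∃ l : List (List Bool), (l.length = c ∧ l.Nodup) ∧ ∀ α ∈ l, α.length = n ∧ (α, j) ∈ T

theorem primrecPred_nodup {β : Type*} [Primcodable β] :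
    PrimrecPred fun l : List β => l.Nodup := by
  have h : PrimrecPred fun l : List β => ∀ j < l.length, ∀ i < j, l[i]? ≠ l[j]? := by
    refine primrecPred_forall_lt (p := fun l j => ∀ i < j, l[i]? ≠ l[j]?) (by fun_prop) ?_
    refine primrecPred_forall_lt (f := fun x : List β × ℕ => x.2)
      (p := fun x i => x.1[i]? ≠ x.1[x.2]?) (by fun_prop) ?_
    exact (primrecPred_eq (by fun_prop) (by fun_prop)).not
  refine h.of_eq fun l => ?_
  rw [List.nodup_iff_getElem?_ne_getElem?]
  exact ⟨fun h i j hij hj => h j hj i hij, fun h j hj i hij => h i j hij hj⟩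

theorem Sig.many {Z : ℕ → Bool} {T : ℕ → Set (List Bool × ℕ)}
    (hT : Sig Z fun x : ℕ × List Bool × ℕ => x.2 ∈ T x.1) {c : ℕ → ℕ} (hc : Primrec c) :
    Sig Z fun x : ℕ × ℕ × ℕ => Many (T x.1) (c x.1) x.2.1 x.2.2 := by
  have h1 := hT.comp (f := fun x : ((ℕ × ℕ × ℕ) × List (List Bool)) × List Bool =>
    (x.1.1.1, x.2, x.1.1.2.2)) (by fun_prop)
  have h2 : PrimrecPred fun x : ((ℕ × ℕ × ℕ) × List (List Bool)) × List Bool =>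
      x.2.length = x.1.1.2.1 := by fun_prop
  have h3 := Sig.forall_mem (f := fun x : (ℕ × ℕ × ℕ) × List (List Bool) => x.2)
    (p := fun x α => α.length = x.1.2.1 ∧ (α, x.1.2.2) ∈ T x.1.1) (by fun_prop)
    ((Sig.of_primrec h2).and h1)
  have h4 : PrimrecPred fun x : (ℕ × ℕ × ℕ) × List (List Bool) =>
      x.2.length = c x.1.1 ∧ x.2.Nodup :=
    (primrecPred_eq (by fun_prop) (by fun_prop)).and (primrecPred_nodup.comp Primrec.snd)
  exact ((Sig.of_primrec h4).and h3).ex'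

theorem mul_wt_many_le (T : Set (List Bool × ℕ)) (c d : ℕ) :
    c * wt (fun x : ℕ × ℕ => x.2 + d) {x | Many T c x.1 x.2} ≤
      wt (fun x : List Bool × ℕ => x.2 + d) T := by
  classical
  have h : ∀ x : ℕ × ℕ, ∃ F : Finset (List Bool × ℕ), Many T c x.1 x.2 → F.card = c ∧
      ∀ y ∈ F, y ∈ T ∧ y.2 + d = x.2 + d ∧ (y.1.length, y.2) = x := by
    rintro ⟨n, j⟩
    by_cases h : Many T c n j
    · obtain ⟨l, ⟨h1, h2⟩, h3⟩ := h
      refine ⟨l.toFinset.map ⟨fun α => (α, j), fun α β h => (Prod.ext_iff.1 h).1⟩, fun _ => ⟨?_, ?_⟩⟩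
      · rw [Finset.card_map, List.toFinset_card_of_nodup h2, h1]
      · intro y hy
        obtain ⟨α, hα, rfl⟩ := Finset.mem_map.1 hy
        obtain ⟨h4, h5⟩ := h3 α (List.mem_toFinset.1 hα)
        exact ⟨h5, rfl, Prod.ext h4 rfl⟩
    · exact ⟨∅, fun h' => absurd h' h⟩
  choose F hF using h
  exact mul_wt_le F (fun y => (y.1.length, y.2)) (fun x hx => (hF x hx).1)
    fun x hx => (hF x hx).2

/-- The levels above which every value is taken by many strings of length `n`. -/
def level (T : Set (List Bool × ℕ)) (c q : ℕ) : Set (ℕ × ℕ) :=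
  {x | x.2 ≤ x.1 + q + 4 ∧ ∀ j < x.1 + q + 5, x.2 < j → Many T c x.1 j}

theorem wt_level_le {T : Set (List Bool × ℕ)} {d q : ℕ}
    (hT : wt (fun x : List Bool × ℕ => x.2 + d) T ≤ 1) :
    wt (fun x : ℕ × ℕ => x.2) {x | Many T (2 ^ (d + q + 4)) x.1 x.2} ≤ 2⁻¹ ^ (q + 4) ∧
    wt (fun x : ℕ × ℕ => x.2) (level T (2 ^ (d + q + 4)) q) ≤ 2⁻¹ ^ (q + 2) := by
  have h1 : wt (fun x : ℕ × ℕ => x.2) {x | Many T (2 ^ (d + q + 4)) x.1 x.2} ≤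
      2⁻¹ ^ (q + 4) := by
    have := (mul_wt_many_le T (2 ^ (d + q + 4)) d).trans hT
    rw [wt_add, ← mul_assoc] at this
    have h2 : ((2 ^ (d + q + 4) : ℕ) : ℝ≥0∞) * 2⁻¹ ^ d = 2 ^ (q + 4) := by
      rw [add_assoc, pow_add]
      push_cast
      rw [mul_right_comm, ← mul_pow, ENNReal.mul_inv_cancel (by simp) (by simp), one_pow, one_mul]
    rw [h2] at this
    rw [← ENNReal.inv_pow, ENNReal.le_inv_iff_mul_le, mul_comm]
    exact this
  refine ⟨h1, ?_⟩
  have hsub : level T (2 ^ (d + q + 4)) q ⊆ (fun n => (n, n + q + 4)) '' Set.univ ∪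
      (fun x : ℕ × ℕ => (x.1, x.2 + 1)) ⁻¹' {x | Many T (2 ^ (d + q + 4)) x.1 x.2} := by
    rintro ⟨n, i⟩ ⟨hi, h⟩
    dsimp only at hi h
    rcases hi.eq_or_lt with rfl | hi
    · exact Or.inl ⟨n, trivial, rfl⟩
    · exact Or.inr (h (i + 1) (by omega) (by omega))
  refine (wt_mono hsub).trans ((wt_union_le _ _ _).trans ?_)
  have h2 : wt (fun x : ℕ × ℕ => x.2) ((fun n => (n, n + q + 4)) '' Set.univ) ≤
      2⁻¹ ^ (q + 3) := by
    rw [wt_image fun m n h => (Prod.ext_iff.1 h).1]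
    have h3 : (fun n : ℕ => n + q + 4) = fun n => (n + 1) + (q + 3) := by
      funext n
      omega
    change wt (fun n : ℕ => n + q + 4) Set.univ ≤ _
    rw [h3, wt_add]
    refine (mul_le_mul_right (b := wt (fun n : ℕ => n + 1) Set.univ) (c := 1) ?_ _).trans_eq
      (mul_one _)
    rw [wt, tsum_univ fun n : ℕ => (2⁻¹ : ℝ≥0∞) ^ (n + 1)]
    exact tsum_encode_le ℕ
  have h3 : wt (fun x : ℕ × ℕ => x.2)
      ((fun x : ℕ × ℕ => (x.1, x.2 + 1)) ⁻¹' {x | Many T (2 ^ (d + q + 4)) x.1 x.2}) ≤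
      2⁻¹ ^ (q + 3) := by
    have := (wt_preimage (f := fun x : ℕ × ℕ => (x.1, x.2 + 1)) (g := fun x : ℕ × ℕ => x.2)
      (fun x y h => by
        simp only [Prod.mk.injEq, Nat.add_right_cancel_iff] at h
        exact Prod.ext h.1 h.2)).trans h1
    rw [wt_add (fun x : ℕ × ℕ => x.2), pow_one, pow_succ' _ (q + 3)] at this
    exact (ENNReal.mul_le_mul_iff_right (by simp) (by simp)).1 this
  refine (add_le_add h2 h3).trans_eq ?_
  rw [pow_succ _ (q + 2), ← mul_add, ENNReal.inv_two_add_inv_two, mul_one]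

theorem isClosed_pre (S : Set (List Bool)) (m : ℕ) : IsClosed {X : ℕ → Bool | pre X m ∈ S} := by
  have : {X : ℕ → Bool | pre X m ∈ S} = (Cyl {τ | τ.length = m ∧ τ ∉ S})ᶜ := by
    ext X
    rw [Set.mem_compl_iff, mem_Cyl]
    constructor
    · rintro h ⟨n, hn1, hn2⟩
      rw [length_pre] at hn1
      exact hn2 (hn1 ▸ h)
    · intro h
      by_contra h'
      exact h ⟨m, by simp, h'⟩
  rw [this]
  exact (isOpen_Cyl _).isClosed_compl

/-- A path which is one of few paths is isolated. -/
theorem exists_isolating {P : Set (ℕ → Bool)} {c : ℕ}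
    (hP : ∀ n, ¬ ∃ l : List (List Bool), (l.length = c ∧ l.Nodup) ∧ ∀ α ∈ l, ∃ X ∈ P, pre X n = α)
    (Y : ℕ → Bool) : ∃ k, ∀ X ∈ P, pre X k = pre Y k → X = Y := by
  classical
  have hfin : P.Finite := by
    by_contra hinf
    obtain ⟨F, hF, hFc⟩ := Set.Infinite.exists_subset_card_eq hinf c
    have : ∃ n, Set.InjOn (fun X => pre X n) (F : Set (ℕ → Bool)) := by
      have h : ∀ p : (ℕ → Bool) × (ℕ → Bool), ∃ k, p.1 ≠ p.2 → p.1 k ≠ p.2 k := by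
        intro p
        by_cases hp : p.1 = p.2
        · exact ⟨0, fun h => absurd hp h⟩
        · obtain ⟨k, hk⟩ := Function.ne_iff.1 hp
          exact ⟨k, fun _ => hk⟩
      choose k hk using h
      refine ⟨(F ×ˢ F).sup k + 1, fun X hX Z hZ h => ?_⟩
      by_contra hne
      refine hk (X, Z) hne (pre_eq_pre_iff.1 h _ (Nat.lt_succ_of_le ?_))
      exact Finset.le_sup (f := k) (Finset.mk_mem_product hX hZ)
    obtain ⟨n, hn⟩ := this
    refine hP n ⟨(F.image fun X => pre X n).toList, ⟨?_, Finset.nodup_toList _⟩, ?_⟩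
    · rw [Finset.length_toList, Finset.card_image_of_injOn hn, hFc]
    · intro α hα
      obtain ⟨X, hX, rfl⟩ := Finset.mem_image.1 (Finset.mem_toList.1 hα)
      exact ⟨X, hF hX, rfl⟩
  have h : ∀ X : ℕ → Bool, ∃ k, X ≠ Y → X k ≠ Y k := by
    intro X
    by_cases hp : X = Y
    · exact ⟨0, fun h => absurd hp h⟩
    · obtain ⟨k, hk⟩ := Function.ne_iff.1 hp
      exact ⟨k, fun _ => hk⟩
  choose k hk using h
  refine ⟨hfin.toFinset.sup k + 1, fun X hX h => ?_⟩
  by_contra hne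
  refine hk X hne (pre_eq_pre_iff.1 h _ (Nat.lt_succ_of_le ?_))
  exact Finset.le_sup (f := k) (hfin.mem_toFinset.2 hX)

theorem exists_mem_level_not_many {T : Set (List Bool × ℕ)} {c q : ℕ}
    (h0 : ∀ n, ¬ Many T c n 0) (n : ℕ) : ∃ i, (n, i) ∈ level T c q ∧ ¬ Many T c n i := by
  classical
  have hex : ∃ i, (n, i) ∈ level T c q := ⟨n + q + 4, le_rfl, fun j h1 h2 => by
    dsimp only at h1 h2
    omega⟩
  refine ⟨Nat.find hex, Nat.find_spec hex, fun hM => ?_⟩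
  obtain ⟨h1, h2⟩ := Nat.find_spec hex
  rcases hi : Nat.find hex with _ | i
  · exact h0 n (hi ▸ hM)
  · rw [hi] at h1 h2 hM
    refine Nat.find_min hex (m := i) (by omega) ⟨?_, fun j hj hij => ?_⟩
    · dsimp only at h1 ⊢
      omega
    · dsimp only at hj hij h2
      rcases (Nat.succ_le_of_lt hij).eq_or_lt with h | h
      · exact h ▸ hM
      · exact h2 j hj h

theorem exists_selfCover {A : Set ℕ} (H : ∀ X, MLRandom ∅ X → MLRandom A X) :
    ∃ (J : Set (List Bool × ℕ)) (L : Set (ℕ × ℕ)) (c q : ℕ),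
      (Sig (chr ∅) fun x => x ∈ J) ∧ (Sig (chr ∅) fun x => x ∈ L) ∧
      (∀ n i, (n, i) ∈ L → i ≤ n + q + 4) ∧
      (∀ n i, (n, i) ∈ L → (pre (chr A) n, i) ∈ J) ∧
      ∀ n, ∃ i, (n, i) ∈ L ∧ ¬ Many J c n i := by
  obtain ⟨T, hT, hT1, hT2⟩ := exists_trunc (β := List Bool × ℕ)
    (g := fun e x => x.2 + (Nat.unpair e).2) (by fun_prop)
  let c : ℕ → ℕ := fun q => 2 ^ ((Nat.unpair q).2 + q + 4)
  have hc : Primrec c := by fun_prop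
  have hL : Sig (chr ∅) fun x : ℕ × ℕ × ℕ => x.2 ∈ level (T x.1) (c x.1) x.1 := by
    have h1 := (Sig.many hT hc).comp (f := fun x : (ℕ × ℕ × ℕ) × ℕ => (x.1.1, x.1.2.1, x.2))
      (by fun_prop)
    have h2 : PrimrecPred fun x : (ℕ × ℕ × ℕ) × ℕ => x.1.2.2 < x.2 := by fun_prop
    have h3 := Sig.forall_lt (f := fun x : ℕ × ℕ × ℕ => x.2.1 + x.1 + 5)
      (p := fun x j => x.2.2 < j → Many (T x.1) (c x.1) x.2.1 j) (by fun_prop) (Sig.imp h2 h1)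
    have h4 : PrimrecPred fun x : ℕ × ℕ × ℕ => x.2.2 ≤ x.2.1 + x.1 + 4 := by fun_prop
    exact (Sig.of_primrec h4).and h3
  let L : Set (ℕ × ℕ) := ⋃ q, level (T q) (c q) q
  have hLwt : wt (fun x : ℕ × ℕ => x.2) L < 1 := by
    calc wt (fun x : ℕ × ℕ => x.2) L
        ≤ ∑' q, wt (fun x : ℕ × ℕ => x.2) (level (T q) (c q) q) := wt_iUnion_le _ _
      _ ≤ ∑' q : ℕ, 2⁻¹ * 2⁻¹ ^ (Encodable.encode q + 1) := by
          refine ENNReal.tsum_le_tsum fun q => ((wt_level_le (hT1 q)).2).trans_eq ?_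
          rw [pow_succ' _ (q + 1), Encodable.encode_nat]
      _ ≤ 2⁻¹ * 1 := by
          rw [ENNReal.tsum_mul_left]
          gcongr
          exact tsum_encode_le ℕ
      _ < 1 := by
          rw [mul_one]
          exact ENNReal.inv_lt_one.2 ENNReal.one_lt_two
  have hLS : Sig (chr ∅) fun x => x ∈ L := by
    refine (hL.comp (f := fun x : (ℕ × ℕ) × ℕ => (x.2, x.1)) (by fun_prop)).ex'.of_eq fun x => ?_
    simp [L]
  let I : Set (List Bool × ℕ) := {x | x.1 = pre (chr A) x.1.length ∧ (x.1.length, x.2) ∈ L}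
  have hIS : Sig (chr A) fun x => x ∈ I := by
    have h1 := Sig.of_pre (Z := chr A) (f := fun x : List Bool × ℕ => x.1.length)
      (Q := fun x α => x.1 = α) (by fun_prop) (by fun_prop)
    exact h1.and (hLS.of_zero.comp (f := fun x : List Bool × ℕ => (x.1.length, x.2))
      (by fun_prop))
  have hIwt : wt (fun x : List Bool × ℕ => x.2) I < 1 := by
    have hI : I = (fun x : ℕ × ℕ => (pre (chr A) x.1, x.2)) '' L := by
      ext ⟨α, i⟩
      constructor
      · rintro ⟨h1, h2⟩
        exact ⟨_, h2, Prod.ext h1.symm rfl⟩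
      · rintro ⟨⟨n, i⟩, h, h'⟩
        obtain ⟨rfl, rfl⟩ := Prod.mk.inj h'
        exact ⟨by simp, by simpa using h⟩
    rw [hI, wt_image]
    · exact hLwt
    · rintro ⟨n, i⟩ ⟨m, j⟩ h
      obtain ⟨h1, h2⟩ := Prod.mk.inj h
      have := congrArg List.length h1
      simp only [length_pre] at this
      exact Prod.ext this h2
  obtain ⟨J, hJ, hIJ, hJwt⟩ := exists_cover H (by fun_prop) hIS hIwt
  obtain ⟨e₀, he⟩ := hT2 (fun _ => J) (hJ.comp (f := fun x : ℕ × List Bool × ℕ => x.2)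
    (by fun_prop))
  obtain ⟨d, hd⟩ : ∃ d : ℕ, wt (fun x : List Bool × ℕ => x.2) J ≤ 2 ^ d := by
    obtain ⟨d, hd⟩ := ENNReal.exists_nat_gt hJwt
    refine ⟨d, hd.le.trans ?_⟩
    exact_mod_cast Nat.lt_two_pow_self.le
  set q := Nat.pair e₀ d with hq
  have hqd : (Nat.unpair q).2 = d := by rw [hq, Nat.unpair_pair]
  have hJT : T q = J := by
    refine he d ?_
    rw [← hq, wt_add, hqd]
    calc (2⁻¹ : ℝ≥0∞) ^ d * wt (fun x : List Bool × ℕ => x.2) J ≤ 2⁻¹ ^ d * 2 ^ d := by gcongr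
      _ = 1 := by rw [← mul_pow, ENNReal.inv_mul_cancel (by simp) (by simp), one_pow]
  have hJ1 := (wt_level_le (q := q) (hT1 q)).1
  refine ⟨J, level (T q) (c q) q, c q, q, hJ, hL.comp (f := fun x => (q, x)) (by fun_prop),
    fun n i h => h.1, fun n i h => hIJ ⟨by simp, ?_⟩, fun n => ?_⟩
  · rw [length_pre]
    exact Set.mem_iUnion.2 ⟨q, h⟩
  · rw [← hJT]
    refine exists_mem_level_not_many (fun m hm => ?_) n
    have h1 : wt (fun x : ℕ × ℕ => x.2) (({(m, 0)} : Finset (ℕ × ℕ)) : Set (ℕ × ℕ)) ≤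
        2⁻¹ ^ (q + 4) := (wt_mono (by simpa using hm)).trans hJ1
    rw [wt_finset] at h1
    simp only [Finset.sum_singleton, pow_zero] at h1
    refine absurd h1 (not_le.2 (pow_lt_one₀ (by simp) ?_ (by omega)))
    exact ENNReal.inv_lt_one.2 ENNReal.one_lt_two

/-- If `A` is low for randomness then the initial segments of `A` have a decreasing c.e.
approximation. -/
theorem exists_approx {A : Set ℕ} (H : ∀ X, MLRandom ∅ X → MLRandom A X) :
    ∃ D : ℕ → List Bool → Prop, (Sig (chr ∅) fun x : ℕ × List Bool => D x.1 x.2) ∧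
      (∀ m n α, m ≤ n → D n α → D m α) ∧
      ∀ α, (∀ n, D n α) ↔ α = pre (chr A) α.length := by
  obtain ⟨J, L, c, q, hJ, hL, hLq, hLJ, hM⟩ := exists_selfCover H
  let P : Set (ℕ → Bool) := {X | ∀ m i, (m, i) ∈ L → (pre X m, i) ∈ J}
  obtain ⟨k, hk⟩ := exists_isolating (P := P) (c := c) (by
    rintro n ⟨l, hl, h⟩
    obtain ⟨i, hi, hMi⟩ := hM n
    refine hMi ⟨l, hl, fun α hα => ?_⟩
    obtain ⟨X, hX, rfl⟩ := h α hα
    exact ⟨length_pre _ _, hX n i hi⟩) (chr A)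
  obtain ⟨R, hR, hRm, hRL⟩ := hL.zero_stage
  refine ⟨fun n α => ∃ β : List Bool, ((α <+: β ∧ pre (chr A) k <+: β) ∧ n ≤ β.length) ∧
    ∀ m < n + 1, ∀ i < m + q + 5, R (m, i) n → (β.take m, i) ∈ J, ?_, ?_, fun α => ?_⟩
  · have h1 := hR.comp (f := fun x : (((ℕ × List Bool) × List Bool) × ℕ) × ℕ =>
      ((x.1.2, x.2), x.1.1.1.1)) (by fun_prop)
    have h2 := hJ.comp (f := fun x : (((ℕ × List Bool) × List Bool) × ℕ) × ℕ =>
      (x.1.1.2.take x.1.2, x.2)) (by fun_prop)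
    have h3 := Sig.forall_lt (f := fun x : ((ℕ × List Bool) × List Bool) × ℕ => x.2 + q + 5)
      (p := fun x i => R (x.2, i) x.1.1.1 → (x.1.2.take x.2, i) ∈ J) (by fun_prop)
      (Sig.imp h1 h2)
    have h4 := Sig.forall_lt (f := fun x : (ℕ × List Bool) × List Bool => x.1.1 + 1)
      (p := fun x m => ∀ i < m + q + 5, R (m, i) x.1.1 → (x.2.take m, i) ∈ J) (by fun_prop) h3
    have h5 : PrimrecPred fun x : (ℕ × List Bool) × List Bool =>
        (x.1.2 <+: x.2 ∧ pre (chr A) k <+: x.2) ∧ x.1.1 ≤ x.2.length := by fun_prop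
    exact ((Sig.of_primrec h5).and h4).ex'
  · rintro m n α hmn ⟨β, ⟨h1, h2⟩, h3⟩
    exact ⟨β, ⟨h1, hmn.trans h2⟩, fun j hj i hi hr =>
      h3 j (by omega) i hi (hRm _ _ _ hmn hr)⟩
  · constructor
    · intro h
      let K : ℕ → Set (ℕ → Bool) := fun n => (N α ∩ N (pre (chr A) k)) ∩
        ⋂ (m) (i) (_ : m < n + 1 ∧ i < m + q + 5 ∧ R (m, i) n), {X | pre X m ∈ {τ | (τ, i) ∈ J}}
      have hKc : ∀ n, IsClosed (K n) := fun n =>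
        ((isClosed_N _).inter (isClosed_N _)).inter (isClosed_iInter fun m =>
          isClosed_iInter fun i => isClosed_iInter fun _ => isClosed_pre _ _)
      obtain ⟨X, hX⟩ := IsCompact.nonempty_iInter_of_sequence_nonempty_isCompact_isClosed K
        (fun n => by
          refine Set.inter_subset_inter_right _ fun X hX => ?_
          simp only [Set.mem_iInter] at hX ⊢
          rintro m i ⟨h1, h2, h3⟩
          exact hX m i ⟨by omega, h2, hRm _ _ _ (Nat.le_succ n) h3⟩)
        (fun n => by
          obtain ⟨β, ⟨⟨h1, h2⟩, h3⟩, h4⟩ := h n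
          have hβ := app_mem_N β fun _ => false
          refine ⟨_, ⟨N_subset_N h1 hβ, N_subset_N h2 hβ⟩, ?_⟩
          simp only [Set.mem_iInter]
          rintro m i ⟨h5, h6, h7⟩
          have := h4 m h5 i h6 h7
          rw [← mem_N.1 hβ, take_pre_of_le _ (by omega)] at this
          exact this)
        (hKc 0).isCompact hKc
      rw [Set.mem_iInter] at hX
      have hXP : X ∈ P := by
        intro m i hmi
        obtain ⟨s, hs⟩ := (hRL _).1 hmi
        have := (hX (max m s)).2
        simp only [Set.mem_iInter] at this
        have h1 := hLq m i hmi
        exact this m i ⟨by omega, by omega, hRm _ _ _ (by simp) hs⟩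
      have hXA : X = chr A := hk X hXP (by simpa using mem_N.1 (hX 0).1.2)
      rw [← hXA]
      exact (mem_N.1 (hX 0).1.1).symm
    · intro hα n
      refine ⟨pre (chr A) (max n (max k α.length)), ⟨⟨?_, pre_prefix _ (by simp)⟩, by simp⟩, ?_⟩
      · rw [hα]
        exact pre_prefix _ (by simp)
      · intro m hm i hi hr
        rw [take_pre_of_le _ (by omega)]
        exact hLJ m i ((hRL _).2 ⟨n, hr⟩)

end Approx

section Tests

open scoped ENNReal

theorem exists_GenMLTest {A : Set ℕ} {F : ℕ → Set (List Bool)}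
    (hF : Sig (chr A) fun x : ℕ × List Bool => x.2 ∈ F x.1) (h0 : mu (⋂ i, Cyl (F i)) = 0) :
    ∃ U, GenMLTest A U ∧ ⋂ n, U n = ⋂ i, Cyl (F i) := by
  let B : ℕ → Set (List Bool) := fun k => {σ | ∀ i < k + 1, ∃ j, j ≤ σ.length ∧ σ.take j ∈ F i}
  have hB : ∀ k X, X ∈ Cyl (B k) ↔ ∀ i < k + 1, X ∈ Cyl (F i) := by
    intro k X
    rw [mem_Cyl]
    constructor
    · rintro ⟨n, hn⟩ i hi
      obtain ⟨j, hj1, hj2⟩ := hn i hi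
      rw [length_pre] at hj1
      rw [take_pre_of_le X hj1] at hj2
      exact mem_Cyl.2 ⟨j, hj2⟩
    · intro h
      have h' : ∀ i, ∃ j, i < k + 1 → pre X j ∈ F i := by
        intro i
        by_cases hi : i < k + 1
        · obtain ⟨j, hj⟩ := mem_Cyl.1 (h i hi)
          exact ⟨j, fun _ => hj⟩
        · exact ⟨0, fun h => absurd h hi⟩
      choose j hj using h'
      refine ⟨(Finset.range (k + 1)).sup j, fun i hi => ⟨j i, ?_, ?_⟩⟩
      · rw [length_pre]
        exact Finset.le_sup (Finset.mem_range.2 hi)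
      · rw [take_pre_of_le X (Finset.le_sup (Finset.mem_range.2 hi))]
        exact hj i hi
  have hU : ⋂ n, Cyl (B n) = ⋂ i, Cyl (F i) := by
    ext X
    simp only [Set.mem_iInter, hB]
    exact ⟨fun h i => h i i (Nat.lt_succ_self i), fun h n i _ => h i⟩
  refine ⟨fun k => Cyl (B k), ⟨B, ?_, fun _ => rfl, fun n X hX => ?_, by rw [hU, h0]⟩, hU⟩
  · rw [ceSeqIn_iff]
    have h1 : PrimrecPred fun x : ((ℕ × List Bool) × ℕ) × ℕ => x.2 ≤ x.1.1.2.length := by fun_prop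
    have h2 := hF.comp (f := fun x : ((ℕ × List Bool) × ℕ) × ℕ => (x.1.2, x.1.1.2.take x.2))
      (by fun_prop)
    have h3 := ((Sig.of_primrec h1).and h2).ex'
    exact Sig.forall_lt (f := fun x : ℕ × List Bool => x.1 + 1)
      (p := fun x i => ∃ j, j ≤ x.2.length ∧ x.2.take j ∈ F i) (by fun_prop) h3
  · exact (hB n X).2 fun i hi => (hB (n + 1) X).1 hX i (by omega)

theorem lowForW2Tests_of_low {A : Set ℕ} (H : ∀ X, MLRandom ∅ X → MLRandom A X) :
    LowForW2Tests A := by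
  rintro V ⟨W, hW, hVW, -, hV0⟩
  rw [ceSeqIn_iff] at hW
  obtain ⟨Q, hQ, hQW⟩ := exists_prefixFree hW
  obtain ⟨D, hD, hDm, hDA⟩ := exists_approx H
  let P : ℕ → Set (List Bool) := fun n => {σ | Q n σ (pre (chr A) σ.length)}
  have hPV : ∀ n, Cyl (P n) = V n := fun n => (hQW n).2.trans (hVW n).symm
  let g : ℕ × List Bool × List Bool → ℕ := fun x => x.2.1.length + (x.1 + 2)
  let I : Set (ℕ × List Bool × List Bool) :=
    {x | pre (chr A) x.2.1.length = x.2.2 ∧ Q x.1 x.2.1 x.2.2}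
  have hI : Sig (chr A) fun x => x ∈ I := by
    have h1 := Sig.of_pre (Z := chr A)
      (f := fun x : ℕ × List Bool × List Bool => x.2.1.length)
      (Q := fun x α => α = x.2.2) (by fun_prop) (by fun_prop)
    exact h1.and (Sig.of_primrec (hQ.comp
      (f := fun x : ℕ × List Bool × List Bool => ((x.1, x.2.1), x.2.2)) (by fun_prop)))
  have hIwt : wt g I < 1 := by
    have hsub : I ⊆ ⋃ n, (fun σ : List Bool => (n, σ, pre (chr A) σ.length)) '' P n := by
      rintro ⟨n, σ, α⟩ ⟨h1, h2⟩
      dsimp only at h1 h2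
      subst h1
      exact Set.mem_iUnion.2 ⟨n, σ, h2, rfl⟩
    calc wt g I ≤ ∑' n, wt g ((fun σ : List Bool => (n, σ, pre (chr A) σ.length)) '' P n) :=
          (wt_mono hsub).trans (wt_iUnion_le _ _)
      _ ≤ ∑' n : ℕ, 2⁻¹ * 2⁻¹ ^ (Encodable.encode n + 1) := by
          refine ENNReal.tsum_le_tsum fun n => ?_
          rw [wt_image fun σ τ h => (Prod.mk.inj (Prod.mk.inj h).2).1, ← pow_succ']
          change wt (fun σ : List Bool => σ.length + (n + 2)) (P n) ≤ _
          rw [wt_add, ← mu_Cyl_eq_wt (hQW n).1]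
          exact (mul_le_mul_right prob_le_one _).trans_eq (mul_one _)
      _ ≤ 2⁻¹ * 1 := by
          rw [ENNReal.tsum_mul_left]
          gcongr
          exact tsum_encode_le ℕ
      _ < 1 := by
          rw [mul_one]
          exact ENNReal.inv_lt_one.2 ENNReal.one_lt_two
  obtain ⟨J, hJ, hIJ, hJwt⟩ := exists_cover H (g := g) (by fun_prop) hI hIwt
  let K : ℕ → Set (List Bool × List Bool) := fun n =>
    {x | (n, x) ∈ J ∧ x.2.length = x.1.length ∧ Q n x.1 x.2}
  let E : ℕ → ℕ → Set (List Bool) := fun n m => {σ | ∃ α, (σ, α) ∈ K n ∧ D m α}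
  have hVE : ∀ n m, V n ⊆ Cyl (E n m) := by
    intro n m X hX
    rw [← hPV] at hX
    obtain ⟨k, hk⟩ := mem_Cyl.1 hX
    refine mem_Cyl.2 ⟨k, pre (chr A) (pre X k).length, ⟨hIJ ⟨rfl, hk⟩, by simp, hk⟩, ?_⟩
    exact (hDA _).2 (by simp) m
  have hnull : ∀ n, mu ((⋂ m, Cyl (E n m)) \ V n) = 0 := by
    intro n
    have hsum : wt (fun x : List Bool × List Bool => x.1.length) (K n) ≠ ⊤ := by
      intro htop
      have h1 := wt_preimage (f := fun x : List Bool × List Bool => (n, x))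
        (fun x y h => (Prod.mk.inj h).2) (g := g) (S := J)
      change wt (fun x : List Bool × List Bool => x.1.length + (n + 2)) _ ≤ _ at h1
      rw [wt_add] at h1
      have h2 : wt (fun x : List Bool × List Bool => x.1.length)
          ((fun x : List Bool × List Bool => (n, x)) ⁻¹' J) = ⊤ :=
        top_le_iff.1 (htop.ge.trans (wt_mono fun x hx => hx.1))
      rw [h2, ENNReal.mul_top (by simp)] at h1
      exact hJwt (top_le_iff.1 h1)
    have hae := ae_finite_setOfPred_mem (μ := mu) (s := fun x : K n => N x.1.1) (by
      simp only [mu_N]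
      exact hsum)
    refine measure_mono_null (fun X hX => ?_) (ae_iff.1 hae)
    intro hfin
    refine hX.2 ?_
    have h1 : ∀ m, ∃ x : K n, X ∈ N x.1.1 ∧ D m x.1.2 := by
      intro m
      obtain ⟨k, α, hα, hDα⟩ := mem_Cyl.1 (Set.mem_iInter.1 hX.1 m)
      exact ⟨⟨_, hα⟩, mem_N_pre X k, hDα⟩
    choose x hxN hxD using h1
    obtain ⟨y, hy, hy'⟩ : ∃ y ∈ {i : K n | X ∈ N i.1.1}, ∃ᶠ m in atTop, x m = y := by
      by_contra! hcon
      obtain ⟨m, hm⟩ := ((eventually_all_finite hfin).2 fun y hy =>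
        hcon y hy).exists
      exact hm (x m) (hxN m) rfl
    have hα : y.1.2 = pre (chr A) y.1.2.length := (hDA _).1 fun m => by
      obtain ⟨k, hk, rfl⟩ := frequently_atTop.1 hy' m
      exact hDm m k _ hk (hxD k)
    rw [y.2.2.1] at hα
    rw [← hPV]
    refine mem_Cyl.2 ⟨y.1.1.length, ?_⟩
    have hXy : pre X y.1.1.length = y.1.1 := hy
    rw [hXy]
    have := y.2.2.2
    rw [hα] at this
    exact this
  have hEs : Sig (chr ∅) fun x : ℕ × List Bool => x.2 ∈ E x.1.unpair.1 x.1.unpair.2 := by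
    have h1 := hJ.comp (f := fun x : (ℕ × List Bool) × List Bool =>
      (x.1.1.unpair.1, x.1.2, x.2)) (by fun_prop)
    have h2 := hQ.comp (f := fun x : (ℕ × List Bool) × List Bool =>
      ((x.1.1.unpair.1, x.1.2), x.2)) (by fun_prop)
    have h3 : PrimrecPred fun x : (ℕ × List Bool) × List Bool => x.2.length = x.1.2.length := by
      fun_prop
    have h4 := hD.comp (f := fun x : (ℕ × List Bool) × List Bool => (x.1.1.unpair.2, x.2))
      (by fun_prop)
    exact ((h1.and ((Sig.of_primrec h3).and (Sig.of_primrec h2))).and h4).ex'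
  have hpair : ∀ X, X ∈ ⋂ i : ℕ, Cyl (E i.unpair.1 i.unpair.2) ↔ ∀ n m, X ∈ Cyl (E n m) := by
    intro X
    rw [Set.mem_iInter]
    exact ⟨fun h n m => by simpa using h (Nat.pair n m), fun h i => h _ _⟩
  obtain ⟨U, hU, hUE⟩ := exists_GenMLTest hEs (by
    refine measure_mono_null (t := (⋂ n, V n) ∪ ⋃ n, ((⋂ m, Cyl (E n m)) \ V n)) ?_
      (measure_union_null hV0 (measure_iUnion_null hnull))
    intro X hX
    by_cases hXV : ∀ n, X ∈ V n
    · exact Or.inl (Set.mem_iInter.2 hXV)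
    · push Not at hXV
      obtain ⟨n, hn⟩ := hXV
      exact Or.inr (Set.mem_iUnion.2 ⟨n, Set.mem_iInter.2 ((hpair X).1 hX n), hn⟩))
  refine ⟨U, hU, ?_⟩
  rw [hUE]
  exact fun X hX => (hpair X).2 fun n m => hVE n m (Set.mem_iInter.1 hX n)

theorem lowForW2Randomness_of_tests {A : Set ℕ} (H : LowForW2Tests A) :
    LowForW2Randomness A := by
  intro X hX V hV hXV
  obtain ⟨U, hU, hVU⟩ := H V hV
  exact hX U hU (hVU hXV)

end Tests

section Lowness

open scoped ENNReal

theorem exists_tail_notMem {W : Set (List Bool)} (hW : Sig (chr ∅) fun σ => σ ∈ W)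
    (h1 : mu (Cyl W) < 1) {X : ℕ → Bool} (hX : MLRandom ∅ X) :
    ∃ ρ Y, X = app ρ Y ∧ Y ∉ Cyl W := by
  obtain ⟨Q, hQ, hQW⟩ := exists_prefixFree (γ := Unit) (W := fun _ => W)
    (hW.comp (f := fun x : Unit × List Bool => x.2) (by fun_prop))
  obtain ⟨hPF, hCyl⟩ := hQW ()
  set P : Set (List Bool) := {σ | Q () σ (pre (chr ∅) σ.length)}
  have hP : Sig (chr ∅) fun σ => σ ∈ P :=
    Sig.of_pre (f := fun σ : List Bool => σ.length) (Q := fun σ α => Q () σ α)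
      (hQ.comp (f := fun x : List Bool × List Bool => (((), x.1), x.2)) (by fun_prop)) (by fun_prop)
  rw [← hCyl] at h1 ⊢
  by_contra! hcon
  have key : ∀ n ρ Y, X = app ρ Y → Y ∈ Cyl (concatPow P n) := by
    intro n
    induction n with
    | zero => exact fun ρ Y _ => mem_Cyl.2 ⟨0, [], by simp, by simp⟩
    | succ n ih =>
      intro ρ Y hY
      obtain ⟨k, hk⟩ := mem_Cyl.1 (hcon ρ Y hY)
      have h2 := ih (ρ ++ pre Y k) (tail Y k) (by rw [app_append, app_tail, hY])
      obtain ⟨m, hm⟩ := mem_Cyl.1 (app_mem_Cyl_append (σ := pre Y k) h2)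
      rw [app_tail] at hm
      rw [concatPow_succ]
      exact mem_Cyl.2 ⟨m, Set.mem_biUnion hk hm⟩
  exact not_MLRandom_of_concatPow hP (by rwa [← mu_Cyl_eq_wt hPF])
    (fun n => key n [] X (app_nil X).symm) hX

theorem preimage_app_Cyl (σ : List Bool) (W : Set (List Bool)) :
    app σ ⁻¹' Cyl W = Cyl {ρ | ∃ k, k ≤ (σ ++ ρ).length ∧ (σ ++ ρ).take k ∈ W} := by
  ext Y
  rw [Set.mem_preimage, mem_Cyl, mem_Cyl]
  constructor
  · rintro ⟨k, hk⟩
    refine ⟨k, k, by simp, ?_⟩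
    rw [← pre_app, take_pre_of_le _ (by omega)]
    exact hk
  · rintro ⟨n, k, hk, hkW⟩
    rw [← pre_app] at hk hkW
    rw [take_pre_of_le _ (by simpa using hk)] at hkW
    exact ⟨k, hkW⟩

theorem Sig.shift {W : Set (List Bool)} {Z : ℕ → Bool} (hW : Sig Z fun σ => σ ∈ W)
    (σ : List Bool) :
    Sig Z fun ρ => ρ ∈ {ρ | ∃ k, k ≤ (σ ++ ρ).length ∧ (σ ++ ρ).take k ∈ W} := by
  have h1 : PrimrecPred fun x : List Bool × ℕ => x.2 ≤ (σ ++ x.1).length := by fun_prop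
  have h2 := hW.comp (f := fun x : List Bool × ℕ => (σ ++ x.1).take x.2) (by fun_prop)
  exact ((Sig.of_primrec h1).and h2).ex'

theorem mu_N_diff {E : Set (ℕ → Bool)} (hE : MeasurableSet E) (σ : List Bool) :
    mu (N σ \ E) = 2⁻¹ ^ σ.length * (1 - mu (app σ ⁻¹' E)) := by
  rw [Set.sdiff_eq, Set.inter_comm, mu_inter_N hE.compl, Set.preimage_compl,
    prob_compl_eq_one_sub (measurable_app σ hE)]

theorem exists_extension {G : ℕ → Set (ℕ → Bool)} (hG : GenMLTest ∅ G) {X : ℕ → Bool}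
    (hX : MLRandom ∅ X) {T : Set (List Bool)}
    (hXT : ∀ ρ σ Y, X = app ρ Y → app σ Y ∈ Cyl T) (e : ℕ) {σ : List Bool} {W : Set (List Bool)}
    (hW : Sig (chr ∅) fun σ => σ ∈ W) (hσ : mu (N σ \ Cyl W) ≠ 0) :
    ∃ τ W', (Sig (chr ∅) fun σ => σ ∈ W') ∧ mu (N τ \ Cyl W') ≠ 0 ∧ σ <+: τ ∧ e ≤ τ.length ∧
      N τ ⊆ Cyl T ∧ W ⊆ W' ∧ ∃ n, G n ⊆ Cyl W' := by
  obtain ⟨B, hB, hGB, hGm, hG0⟩ := hG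
  rw [ceSeqIn_iff] at hB
  have hGmeas : ∀ n, MeasurableSet (G n) := fun n => hGB n ▸ measurableSet_Cyl _
  have hlim := tendsto_measure_iInter_atTop (μ := mu) (s := G)
    (fun n => (hGmeas n).nullMeasurableSet) (antitone_nat_of_succ_le hGm)
    ⟨0, measure_ne_top _ _⟩
  rw [hG0] at hlim
  obtain ⟨n, hn⟩ := (hlim.eventually_lt_const (pos_iff_ne_zero.2 hσ)).exists
  have hW' : Sig (chr ∅) fun σ => σ ∈ W ∪ B n :=
    hW.or (hB.comp (f := fun σ : List Bool => (n, σ)) (by fun_prop))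
  have hCyl : Cyl (W ∪ B n) = Cyl W ∪ G n := by
    rw [hGB]
    ext Z
    simp only [mem_Cyl, Set.mem_union, ← exists_or]
  have hpos : mu (N σ \ Cyl (W ∪ B n)) ≠ 0 := by
    intro h0
    refine hn.not_ge (le_trans (measure_mono (t := N σ \ Cyl (W ∪ B n) ∪ G n) ?_)
      ((measure_union_le _ _).trans_eq (by rw [h0, zero_add]; rfl)))
    intro Z hZ
    rw [hCyl]
    by_cases hZG : Z ∈ G n
    · exact Or.inr hZG
    · exact Or.inl ⟨hZ.1, fun h => h.elim hZ.2 hZG⟩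
  obtain ⟨ρ, Y, hXY, hY⟩ : ∃ ρ Y, X = app ρ Y ∧ app σ Y ∉ Cyl (W ∪ B n) := by
    have := exists_tail_notMem (hW'.shift σ) (by
      rw [mu_N_diff (measurableSet_Cyl _), preimage_app_Cyl] at hpos
      exact tsub_pos_iff_lt.1 (pos_iff_ne_zero.2 (right_ne_zero_of_mul hpos))) hX
    rwa [← preimage_app_Cyl] at this
  obtain ⟨k, hk⟩ := mem_Cyl.1 (hXT ρ σ Y hXY)
  have hpre : pre (app σ Y) (max e (max k σ.length)) =
      σ ++ pre Y (max e (max k σ.length) - σ.length) := by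
    rw [← pre_app]
    congr 1
    omega
  refine ⟨pre (app σ Y) (max e (max k σ.length)), W ∪ B n, hW', fun h0 => ?_, ?_, by simp,
    N_append_subset_Cyl hk (mem_N_pre _ _) (by simp), Set.subset_union_left, n, ?_⟩
  · rw [hpre, mu_N_diff (measurableSet_Cyl _), mul_eq_zero_iff_left (pow_ne_zero _ (by simp)),
      tsub_eq_zero_iff_le, preimage_app_Cyl] at h0
    refine not_MLRandom_of_notMem (hW'.shift _) (prob_le_one.antisymm h0)
      (X := tail Y (max e (max k σ.length) - σ.length)) ?_ ?_
    · rw [← preimage_app_Cyl, Set.mem_preimage, app_append, app_tail]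
      exact hY
    · rw [hXY, ← app_tail Y (max e (max k σ.length) - σ.length), ← app_append] at hX
      simpa using hX.app []
  · rw [hpre]
    exact List.prefix_append _ _
  · rw [hCyl]
    exact Set.subset_union_right

theorem encodeCode_injective : Function.Injective OracleCode.encodeCode := by
  intro c
  induction c with
  | pair _ _ ihf ihg | comp _ _ ihf ihg | prec _ _ ihf ihg =>
    intro d h
    cases d <;> simp only [OracleCode.encodeCode] at h <;> try omega
    have h' := Nat.pair_eq_pair.1 (mul_left_cancel₀ (by norm_num) (Nat.add_right_cancel h))
    rw [ihf h'.1, ihg h'.2]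
  | rfind' _ ihf =>
    intro d h
    cases d <;> simp only [OracleCode.encodeCode] at h <;> try omega
    rw [ihf (mul_left_cancel₀ (by norm_num) (Nat.add_right_cancel h))]
  | _ =>
    intro d h
    cases d <;> simp only [OracleCode.encodeCode] at h <;> first | rfl | omega

theorem countable_setOf_GenMLTest (A : Set ℕ) : {U | GenMLTest A U}.Countable := by
  have : Countable OracleCode := encodeCode_injective.countable
  refine (Set.countable_range fun c : OracleCode => fun n : ℕ =>
    Cyl {σ | (c.eval (chi A) (Nat.pair n (Encodable.encode σ))).Dom}).mono ?_
  rintro U ⟨W, ⟨c, hc⟩, hU, -⟩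
  refine ⟨c, funext fun n => ?_⟩
  rw [hU]
  exact congrArg Cyl (Set.ext fun σ => (hc n σ).symm)

theorem MLTest.genMLTest {A : Set ℕ} {U : ℕ → Set (ℕ → Bool)} (h : MLTest A U) :
    GenMLTest A U := by
  obtain ⟨W, hW, hU, hm, hmu⟩ := h
  refine ⟨W, hW, hU, hm, le_antisymm (ge_of_tendsto' (x := atTop) (f := fun n : ℕ =>
    (2⁻¹ : ℝ≥0∞) ^ n) ?_ fun n => (measure_mono (Set.iInter_subset _ n)).trans (hmu n)) zero_le⟩
  exact ENNReal.tendsto_pow_atTop_nhds_zero_of_lt_one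
    (ENNReal.inv_lt_one.2 ENNReal.one_lt_two)

theorem low_of_lowForW2Randomness {A : Set ℕ} (H : LowForW2Randomness A) (X : ℕ → Bool)
    (hX : MLRandom ∅ X) : MLRandom A X := by
  intro V hV hXV
  obtain ⟨U, hU, hVU⟩ := exists_MLTest_tail hV
  obtain ⟨T, -, hUT, -⟩ := id hU
  have hXU : ∀ e ρ σ Y, X = app ρ Y → app σ Y ∈ Cyl (T e) := fun e ρ σ Y h =>
    hUT e ▸ Set.mem_iInter.1 (hVU ρ σ Y (h ▸ hXV)) e
  obtain ⟨G, hG⟩ : ∃ G : ℕ → ℕ → Set (ℕ → Bool), {U | GenMLTest ∅ U} = Set.range G := by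
    refine (countable_setOf_GenMLTest ∅).exists_eq_range ?_
    obtain ⟨U', hU', -⟩ := exists_MLTest_tail (A := ∅) (V := fun _ => ∅)
      ⟨fun _ => ∅, ceSeqIn_iff.2 (Sig.of_primrec (primrecPred_const False)),
        by simp [Cyl], by simp, by simp⟩
    exact ⟨U', hU'.genMLTest⟩
  have hGt : ∀ e, GenMLTest ∅ (G e) := fun e => (Set.ext_iff.1 hG (G e)).2 ⟨e, rfl⟩
  let S := {x : List Bool × Set (List Bool) //
    (Sig (chr ∅) fun σ => σ ∈ x.2) ∧ mu (N x.1 \ Cyl x.2) ≠ 0}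
  have hstep : ∀ (e : ℕ) (x : S), ∃ y : S, x.1.1 <+: y.1.1 ∧ e + 1 ≤ y.1.1.length ∧
      N y.1.1 ⊆ Cyl (T e) ∧ x.1.2 ⊆ y.1.2 ∧ ∃ n, G e n ⊆ Cyl y.1.2 := by
    rintro e ⟨⟨σ, W⟩, hW, hσ⟩
    obtain ⟨τ, W', hW', hτ, h⟩ := exists_extension (hGt e) hX (hXU e) (e + 1) hW hσ
    exact ⟨⟨(τ, W'), hW', hτ⟩, h⟩
  choose f hf1 hf2 hf3 hf4 hf5 using hstep
  let x0 : S := ⟨([], ∅), Sig.of_primrec (primrecPred_const False), by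
    simp [Cyl, mu_N]⟩
  let x : ℕ → S := fun n => n.rec x0 f
  have hlen : ∀ n, n ≤ (x n).1.1.length := by
    rintro (_ | n)
    · exact Nat.zero_le _
    · exact hf2 n (x n)
  obtain ⟨Z, hZ⟩ := exists_limit (τ := fun n => (x n).1.1) (fun n => hf1 n (x n)) hlen
  have hmono : Monotone fun n => (x n).1.2 := monotone_nat_of_le_succ fun n => hf4 n (x n)
  have hZx : ∀ n, Z ∉ Cyl (x n).1.2 := by
    intro n hn
    obtain ⟨k, hk⟩ := mem_Cyl.1 hn
    refine (x (max n k)).2.2 ?_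
    rw [Set.sdiff_eq_empty.2 (N_append_subset_Cyl (hmono (le_max_left n k) hk) (hZ (max n k))
      ((le_max_right n k).trans (hlen _))), measure_empty]
  refine H Z (fun V' hV' hZV' => ?_) U hU.genMLTest
    (Set.mem_iInter.2 fun e => hUT e ▸ hf3 e (x e) (hZ (e + 1)))
  obtain ⟨e, rfl⟩ := (Set.ext_iff.1 hG V').1 hV'
  obtain ⟨n, hn⟩ := hf5 e (x e)
  exact hZx (e + 1) (hn (Set.mem_iInter.1 hZV' n))

end Lowness

/-- The equivalence of: low for 1-randomness, low for weak 2-random tests, and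
low for weak 2-randomness. -/
theorem tfae_low_weak2 (A : Set ℕ) :
    List.TFAE
      [ ∀ X : ℕ → Bool, MLRandom ∅ X → MLRandom A X,
        LowForW2Tests A,
        LowForW2Randomness A ] := by
  tfae_have 1 → 2 := lowForW2Tests_of_low
  tfae_have 2 → 3 := lowForW2Randomness_of_tests
  tfae_have 3 → 1 := low_of_lowForW2Randomness
  tfae_finish

end LMD
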